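/- arXiv:2506.16041 — 10 statements merged into one kernel-verified Lean document; each statement's English description precedes it below -/
import Mathlib

section
/- Let θ>0 with θ≠2, α := 2/(2+θ), and let R_α, φ be as in the context. Set C := α(1−α)R_α² / (2(2α−1)), and define u(t,x) := −αx²/(2t) − C t^{2α−1} and m(t,x) := t^{−α} φ(t^{−α} x) for t>0, x∈ℝ. Then for every t>0 and every x with |x| < R_α t^{α}, one has −∂_t u(t,x) + (1/2)(∂_x u(t,x))² = m(t,x)^θ. -/
open MeasureTheory

/-- the self-similar pair (u,m) solves the Hamilton-Jacobi equation
−u_t + (1/2)u_x² = m^θ inside the support of m. -/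
theorem stmt_1 (θ : ℝ) (hθ : 0 < θ) (hθ2 : θ ≠ 2)
    (α : ℝ) (hα : α = 2 / (2 + θ))
    (R : ℝ) (hR : 0 < R)
    (φ : ℝ → ℝ)
    (hφ : ∀ r, φ r = (max ((1/2) * α * (1 - α) * (R^2 - r^2)) 0) ^ (1/θ))
    (hφint : (∫ r : ℝ, φ r) = 1)
    (C : ℝ) (hC : C = α * (1 - α) * R^2 / (2 * (2*α - 1)))
    (u m : ℝ → ℝ → ℝ)
    (hu : ∀ t x, u t x = -(α * x^2 / (2*t)) - C * t ^ (2*α - 1))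
    (hm : ∀ t x, m t x = t ^ (-α) * φ (t ^ (-α) * x)) :
    ∀ t > (0:ℝ), ∀ x : ℝ, |x| < R * t ^ α →
      -(deriv (fun s => u s x) t) + (1/2) * (deriv (fun y => u t y) x)^2
        = (m t x) ^ θ := by
  intro t ht x hx
  have hθ2' : (2 + θ) ≠ 0 := by positivity
  have hα0 : 0 < α := by rw [hα]; positivity
  have hαθ : α * θ = 2 - 2 * α := by
    rw [hα]; field_simp; ring
  have hα1 : 0 < 1 - α := by nlinarith [mul_pos hα0 hθ]
  have hα2 : 2 * α - 1 ≠ 0 := by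
    intro h
    apply hθ2
    have h_half : α = 1 / 2 := by linarith
    rw [h_half] at hαθ
    linarith
  have hCmul : C * (2 * α - 1) = α * (1 - α) * R ^ 2 / 2 := by
    rw [hC, div_mul_eq_mul_div, mul_div_mul_right _ _ hα2]
  have hut : HasDerivAt (fun s => u s x)
      (α * x ^ 2 / (2 * t ^ 2) - C * ((2 * α - 1) * t ^ (2 * α - 2))) t := by
    simp only [hu]
    have h1 : HasDerivAt (fun s : ℝ => s⁻¹) (-(t ^ 2)⁻¹) t := hasDerivAt_inv ht.ne'
    have h2 : HasDerivAt (fun s : ℝ => s ^ (2 * α - 1))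
        ((2 * α - 1) * t ^ (2 * α - 1 - 1)) t :=
      Real.hasDerivAt_rpow_const (Or.inl ht.ne')
    have h3 := (h1.const_mul (-(α * x ^ 2 / 2))).sub (h2.const_mul C)
    have h_exp : 2 * α - 1 - 1 = 2 * α - 2 := by ring
    rw [h_exp] at h3
    refine (h3.congr_deriv ?_).congr_of_eventuallyEq (.of_forall fun s => ?_)
    · ring
    · simp only [Pi.sub_apply]
      ring
  have hux : HasDerivAt (fun y => u t y) (-(α * x / t)) x := by
    simp only [hu]
    have h := ((hasDerivAt_pow 2 x).const_mul (-(α / (2 * t)))).sub_const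
      (C * t ^ (2 * α - 1))
    refine (h.congr_deriv ?_).congr_of_eventuallyEq (.of_forall fun y => ?_)
    · push_cast
      ring
    · ring
  rw [hut.deriv, hux.deriv, hm, hφ]
  have htα : 0 < t ^ (-α) := Real.rpow_pos_of_pos ht _
  have hy : |t ^ (-α) * x| < R := by
    rw [abs_mul, abs_of_pos htα, Real.rpow_neg ht.le, inv_mul_eq_div,
      div_lt_iff₀ (Real.rpow_pos_of_pos ht _)]
    exact hx
  have hy2 : 0 < R ^ 2 - (t ^ (-α) * x) ^ 2 := by
    have := sq_lt_sq' (abs_lt.mp hy).1 (abs_lt.mp hy).2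
    linarith
  have hpos : 0 ≤ (1 / 2) * α * (1 - α) * (R ^ 2 - (t ^ (-α) * x) ^ 2) := by positivity
  have hpow : (t ^ (-α)) ^ θ = t ^ (2 * α - 2) := by
    rw [← Real.rpow_mul ht.le]
    congr 1
    linarith
  have hsq : t ^ (2 * α - 2) * (t ^ (-α)) ^ 2 = (t ^ 2)⁻¹ := by
    rw [← Real.rpow_natCast (t ^ (-α)), ← Real.rpow_mul ht.le, ← Real.rpow_add ht,
      ← Real.rpow_natCast t 2, ← Real.rpow_neg ht.le]
    congr 1
    push_cast
    ring
  rw [max_eq_left hpos, Real.mul_rpow htα.le (Real.rpow_nonneg hpos _), hpow,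
    ← Real.rpow_mul hpos, one_div_mul_cancel hθ.ne', Real.rpow_one]
  have hlhs : α * x ^ 2 / (2 * t ^ 2) = α * x ^ 2 / 2 * (t ^ 2)⁻¹ := by
    field_simp
  have hlhs' : (-(α * x / t)) ^ 2 = α ^ 2 * x ^ 2 * (t ^ 2)⁻¹ := by
    field_simp
  rw [hlhs, hlhs']
  linear_combination t ^ (2 * α - 2) * hCmul + α * (1 - α) / 2 * x ^ 2 * hsq
end

section
/- Let θ>0, α := 2/(2+θ), and let R_α, φ be as in the context. Let a<b, and let m_T : ℝ → [0,∞) be a continuous probability density supported in [a,b] such that for some C₁>1 one has C₁^{−1} min(x−a, b−x)^{1/θ} ≤ m_T(x) ≤ C₁ min(x−a, b−x)^{1/θ} for all x ∈ [a,b]. Let g : [−R_α,R_α] → [a,b] be increasing and continuously differentiable on (−R_α,R_α), with g(−R_α)=a, g(R_α)=b, and suppose that for all y ∈ (−R_α,R_α): ∫_y^{R_α} φ(s) ds = ∫_{g(y)}^{b} m_T(x) dx and g'(y)·m_T(g(y)) = φ(y). Then there exists a constant C>1, depending only on θ, C₁, a, b, such that C^{−1} ≤ g'(y) ≤ C for all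 y ∈ (−R_α,R_α). -/
open MeasureTheory Set

/-- A density bounded below by a power of the distance to the boundary of `[A, B]` has right mass
bounded below by the next power of that distance. -/
lemma le_right_mass {f : ℝ → ℝ} {A B c p x : ℝ} (hc : 0 ≤ c) (hp : 0 ≤ p) (hf : Continuous f)
    (hf0 : ∀ x, 0 ≤ f x) (hlow : ∀ x ∈ Icc A B, c * (min (x - A) (B - x)) ^ p ≤ f x)
    (hx : x ∈ Icc A B) :
    c * (min (x - A) (B - x) / 2) ^ p * (min (x - A) (B - x) / 2) ≤ ∫ s in x..B, f s := by
  obtain ⟨hxA, hxB⟩ := hx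
  set e := min (x - A) (B - x) with he
  have he0 : 0 ≤ e := le_min (by linarith) (by linarith)
  have heA : e ≤ x - A := min_le_left _ _
  have heB : e ≤ B - x := min_le_right _ _
  have hshort : ∫ _ in x..(x + e / 2), c * (e / 2) ^ p ≤ ∫ s in x..(x + e / 2), f s := by
    refine intervalIntegral.integral_mono_on (by linarith) (by simp)
      (hf.intervalIntegrable _ _) fun s hs ↦ ?_
    obtain ⟨hs1, hs2⟩ := hs
    refine le_trans ?_ (hlow s ⟨by linarith, by linarith⟩)
    have : e / 2 ≤ min (s - A) (B - s) := le_min (by linarith) (by linarith)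
    gcongr
  have hsplit := intervalIntegral.integral_add_adjacent_intervals
    (hf.intervalIntegrable (μ := volume) x (x + e / 2)) (hf.intervalIntegrable (x + e / 2) B)
  have hrest : 0 ≤ ∫ s in (x + e / 2)..B, f s :=
    intervalIntegral.integral_nonneg (by linarith) fun s _ ↦ hf0 s
  rw [intervalIntegral.integral_const, smul_eq_mul, add_sub_cancel_left, mul_comm] at hshort
  linarith

/-- A density bounded above by a power of the distance to the boundary of `[A, B]` has right mass
bounded above by the next power of the distance to `B`. -/
lemma right_mass_le {f : ℝ → ℝ} {A B c p x : ℝ} (hc : 0 ≤ c) (hp : 0 ≤ p) (hf : Continuous f)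
    (hup : ∀ x ∈ Icc A B, f x ≤ c * (min (x - A) (B - x)) ^ p) (hx : x ∈ Icc A B) :
    ∫ s in x..B, f s ≤ c * (B - x) ^ p * (B - x) := by
  obtain ⟨hxA, hxB⟩ := hx
  have h : ∫ s in x..B, f s ≤ ∫ _ in x..B, c * (B - x) ^ p := by
    refine intervalIntegral.integral_mono_on hxB (hf.intervalIntegrable _ _) (by simp) fun s hs ↦ ?_
    obtain ⟨hs1, hs2⟩ := hs
    refine (hup s ⟨by linarith, hs2⟩).trans ?_
    have h0 : 0 ≤ min (s - A) (B - s) := le_min (by linarith) (by linarith)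
    have h1 : min (s - A) (B - s) ≤ B - x := (min_le_right _ _).trans (by linarith)
    gcongr
  rwa [intervalIntegral.integral_const, smul_eq_mul, mul_comm] at h

lemma le_left_mass {f : ℝ → ℝ} {A B c p x : ℝ} (hc : 0 ≤ c) (hp : 0 ≤ p) (hf : Continuous f)
    (hf0 : ∀ x, 0 ≤ f x) (hlow : ∀ x ∈ Icc A B, c * (min (x - A) (B - x)) ^ p ≤ f x)
    (hx : x ∈ Icc A B) :
    c * (min (x - A) (B - x) / 2) ^ p * (min (x - A) (B - x) / 2) ≤ ∫ s in A..x, f s := by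
  have hswap : ∀ t, min (-t - -B) (-A - -t) = min (t - A) (B - t) := fun t ↦ by
    rw [min_comm]; congr 1 <;> ring
  have h := le_right_mass (f := fun s ↦ f (-s)) (A := -B) (B := -A) (x := -x) hc hp
    (hf.comp continuous_neg) (fun s ↦ hf0 _)
    (fun s hs ↦ by
      have := hlow (-s) ⟨by linarith [hs.2], by linarith [hs.1]⟩
      rwa [← hswap, neg_neg] at this)
    ⟨by linarith [hx.2], by linarith [hx.1]⟩
  rwa [hswap, intervalIntegral.integral_comp_neg, neg_neg, neg_neg] at h

lemma left_mass_le {f : ℝ → ℝ} {A B c p x : ℝ} (hc : 0 ≤ c) (hp : 0 ≤ p) (hf : Continuous f)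
    (hup : ∀ x ∈ Icc A B, f x ≤ c * (min (x - A) (B - x)) ^ p) (hx : x ∈ Icc A B) :
    ∫ s in A..x, f s ≤ c * (x - A) ^ p * (x - A) := by
  have hswap : ∀ t, min (-t - -B) (-A - -t) = min (t - A) (B - t) := fun t ↦ by
    rw [min_comm]; congr 1 <;> ring
  have h := right_mass_le (f := fun s ↦ f (-s)) (A := -B) (B := -A) (x := -x) hc hp
    (hf.comp continuous_neg)
    (fun s hs ↦ by
      have := hup (-s) ⟨by linarith [hs.2], by linarith [hs.1]⟩
      rwa [← hswap, neg_neg] at this)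
    ⟨by linarith [hx.2], by linarith [hx.1]⟩
  rw [intervalIntegral.integral_comp_neg, neg_neg, neg_neg] at h
  convert h using 2 <;> [congr 2; skip] <;> ring

lemma le_mul_of_rpow_mul_le {c c' p u t : ℝ} (hc : 0 < c) (hp : 0 ≤ p)
    (ht : 0 ≤ t) (h : c * u ^ p * u ≤ c' * t ^ p * t) :
    u ≤ max 1 (c' / c) * t := by
  by_contra! hlt
  set D := max 1 (c' / c)
  have hD1 : 1 ≤ D := le_max_left _ _
  have hD2 : c' ≤ D * c := (div_le_iff₀ hc).1 (le_max_right _ _)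
  have htu : t < u := lt_of_le_of_lt (le_mul_of_one_le_left ht hD1) hlt
  have hupos : 0 < u := ht.trans_lt htu
  have hpow : t ^ p ≤ u ^ p := Real.rpow_le_rpow ht htu.le hp
  have h1 : c' * t ^ p * t ≤ c * u ^ p * (D * t) := by
    calc c' * t ^ p * t ≤ (D * c) * t ^ p * t := by gcongr
      _ ≤ (D * c) * u ^ p * t := by gcongr
      _ = c * u ^ p * (D * t) := by ring
  have h2 : c * u ^ p * (D * t) < c * u ^ p * u := by
    have := Real.rpow_pos_of_pos hupos p
    gcongr
  linarith

/-- If two densities comparable to powers of the distance to the boundary put equal masses on both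
sides of `x` and `x'`, then the distance of `x` to the boundary is controlled by that of `x'`. -/
lemma min_le_of_mass_eq {f f' : ℝ → ℝ} {A B A' B' c c' p x x' : ℝ} (hc : 0 < c) (hc' : 0 ≤ c')
    (hp : 0 ≤ p) (hf : Continuous f) (hf' : Continuous f') (hf0 : ∀ x, 0 ≤ f x)
    (hlow : ∀ x ∈ Icc A B, c * (min (x - A) (B - x)) ^ p ≤ f x)
    (hup : ∀ x ∈ Icc A' B', f' x ≤ c' * (min (x - A') (B' - x)) ^ p)
    (hx : x ∈ Icc A B) (hx' : x' ∈ Icc A' B')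
    (hright : ∫ s in x..B, f s = ∫ s in x'..B', f' s)
    (hleft : ∫ s in A..x, f s = ∫ s in A'..x', f' s) :
    min (x - A) (B - x) ≤ 2 * max 1 (c' / c) * min (x' - A') (B' - x') := by
  have h1 := le_mul_of_rpow_mul_le hc hp (sub_nonneg.2 hx'.2)
    ((le_right_mass hc.le hp hf hf0 hlow hx).trans
      (hright.le.trans (right_mass_le hc' hp hf' hup hx')))
  have h2 := le_mul_of_rpow_mul_le hc hp (sub_nonneg.2 hx'.1)
    ((le_left_mass hc.le hp hf hf0 hlow hx).trans
      (hleft.le.trans (left_mass_le hc' hp hf' hup hx')))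
  rcases min_choice (x' - A') (B' - x') with h | h <;> rw [h] <;> linarith

lemma mul_min_le_sq_sub_sq {R r : ℝ} (hr : r ∈ Icc (-R) R) :
    R * min (r - -R) (R - r) ≤ R ^ 2 - r ^ 2 := by
  obtain ⟨h1, h2⟩ := hr
  rcases le_total 0 r with h | h
  · rw [min_eq_right (by linarith)]; nlinarith
  · rw [min_eq_left (by linarith)]; nlinarith

lemma sq_sub_sq_le_mul_min {R r : ℝ} (hr : r ∈ Icc (-R) R) :
    R ^ 2 - r ^ 2 ≤ 2 * R * min (r - -R) (R - r) := by
  obtain ⟨h1, h2⟩ := hr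
  rcases le_total 0 r with h | h
  · rw [min_eq_right (by linarith)]; nlinarith
  · rw [min_eq_left (by linarith)]; nlinarith

lemma left_mass_eq_of_right_mass_eq {f f' : ℝ → ℝ} {A B A' B' x x' : ℝ} (hf : Continuous f)
    (hf' : Continuous f') (htotal : ∫ s in A..B, f s = ∫ s in A'..B', f' s)
    (hright : ∫ s in x..B, f s = ∫ s in x'..B', f' s) :
    ∫ s in A..x, f s = ∫ s in A'..x', f' s := by
  have h := intervalIntegral.integral_add_adjacent_intervals
    (hf.intervalIntegrable (μ := volume) A x) (hf.intervalIntegrable x B)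
  have h' := intervalIntegral.integral_add_adjacent_intervals
    (hf'.intervalIntegrable (μ := volume) A' x') (hf'.intervalIntegrable x' B')
  linarith

/-- two-sided bound on the derivative of the rescaled terminal Lagrangian
flow g transporting φ onto m_T, with a constant depending only on θ, C₁, a, b. -/
theorem stmt_5 (θ : ℝ) (hθ : 0 < θ)
    (α : ℝ) (hα : α = 2 / (2 + θ))
    (R : ℝ) (hR : 0 < R)
    (φ : ℝ → ℝ)
    (hφ : ∀ r, φ r = (max ((1/2) * α * (1 - α) * (R^2 - r^2)) 0) ^ (1/θ))
    (hφint : (∫ r : ℝ, φ r) = 1)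
    (a b : ℝ) (hab : a < b) (C₁ : ℝ) (hC₁ : 1 < C₁) :
    ∃ C > 1, ∀ mT g g' : ℝ → ℝ,
      Continuous mT →
      (∀ x, 0 ≤ mT x) →
      (∀ x, x ∉ Icc a b → mT x = 0) →
      (∫ x : ℝ, mT x) = 1 →
      (∀ x ∈ Icc a b, C₁⁻¹ * (min (x - a) (b - x)) ^ (1/θ) ≤ mT x) →
      (∀ x ∈ Icc a b, mT x ≤ C₁ * (min (x - a) (b - x)) ^ (1/θ)) →
      StrictMonoOn g (Icc (-R) R) →
      (∀ y ∈ Icc (-R) R, g y ∈ Icc a b) →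
      (∀ y ∈ Ioo (-R) R, HasDerivAt g (g' y) y) →
      ContinuousOn g' (Ioo (-R) R) →
      g (-R) = a → g R = b →
      (∀ y ∈ Ioo (-R) R, (∫ s in y..R, φ s) = ∫ x in (g y)..b, mT x) →
      (∀ y ∈ Ioo (-R) R, g' y * mT (g y) = φ y) →
      ∀ y ∈ Ioo (-R) R, C⁻¹ ≤ g' y ∧ g' y ≤ C := by
  have hα0 : 0 < α := by rw [hα]; positivity
  have hα1 : 0 < 1 - α := by
    rw [hα, sub_pos, div_lt_one (by linarith)]; linarith
  set k := (1 / 2) * α * (1 - α) with hk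
  have hkpos : 0 < k := by positivity
  set p := 1 / θ with hpdef
  have hp : 0 < p := by positivity
  have hφc : Continuous φ := by
    rw [funext hφ]
    exact Continuous.rpow_const (by fun_prop) fun _ ↦ Or.inr hp.le
  have hφ0 : ∀ r, 0 ≤ φ r := fun r ↦ by rw [hφ]; positivity
  have hdist : ∀ r ∈ Icc (-R) R, 0 ≤ min (r - -R) (R - r) := fun r hr ↦
    le_min (by linarith [hr.1]) (by linarith [hr.2])
  have hφlow : ∀ r ∈ Icc (-R) R, (k * R) ^ p * (min (r - -R) (R - r)) ^ p ≤ φ r := by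
    intro r hr
    have h0 := hdist r hr
    rw [hφ, ← Real.mul_rpow (by positivity) h0]
    refine Real.rpow_le_rpow (by positivity) (le_max_of_le_left ?_) hp.le
    rw [mul_assoc k]
    exact mul_le_mul_of_nonneg_left (mul_min_le_sq_sub_sq hr) hkpos.le
  have hφup : ∀ r ∈ Icc (-R) R, φ r ≤ (k * (2 * R)) ^ p * (min (r - -R) (R - r)) ^ p := by
    intro r hr
    have h0 := hdist r hr
    rw [hφ, ← Real.mul_rpow (by positivity) h0]
    refine Real.rpow_le_rpow (by positivity) (max_le ?_ (by positivity)) hp.le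
    rw [mul_assoc k]
    exact mul_le_mul_of_nonneg_left (sq_sub_sq_le_mul_min hr) hkpos.le
  have hφtot : ∫ r in (-R)..R, φ r = 1 := by
    rw [← hφint]
    refine intervalIntegral.integral_eq_integral_of_support_subset fun r hr ↦ ?_
    by_contra hmem
    refine hr ?_
    have hsq : R ^ 2 - r ^ 2 ≤ 0 := by
      rcases not_and_or.1 hmem with h | h <;> nlinarith
    rw [hφ, max_eq_right (mul_nonpos_of_nonneg_of_nonpos hkpos.le hsq), Real.zero_rpow hp.ne']
  have hC₁0 : 0 < C₁ := by linarith
  set cl := (k * R) ^ p with hcl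
  set cu := (k * (2 * R)) ^ p with hcu
  have hclpos : 0 < cl := by positivity
  have hcupos : 0 < cu := by positivity
  set K := 2 * max 1 (cu / C₁⁻¹) with hK
  set K' := 2 * max 1 (C₁ / cl) with hK'
  have hKpos : 0 < K := by positivity
  have hKpos' : 0 < K' := by positivity
  refine ⟨max 2 (max (cu * C₁ * K' ^ p) (C₁ * K ^ p / cl)), lt_max_of_lt_left one_lt_two, ?_⟩
  intro mT g g' hm hm0 hmsupp hmint hmlow hmup hg hgmem _ _ hga hgb hmass hpush y hy
  have hyI : y ∈ Icc (-R) R := Ioo_subset_Icc_self hy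
  have hmtot : ∫ x in a..b, mT x = 1 := by
    rw [← hmint]
    refine intervalIntegral.integral_eq_integral_of_support_subset fun x hx ↦ ?_
    have hxI : x ∈ Icc a b := by
      by_contra h
      exact hx (hmsupp x h)
    refine ⟨lt_of_le_of_ne hxI.1 ?_, hxI.2⟩
    rintro rfl
    have h := hmup a hxI
    rw [sub_self, min_eq_left (by linarith), Real.zero_rpow hp.ne', mul_zero] at h
    exact hx (h.antisymm (hm0 a))
  have hright := hmass y hy
  have hleft := left_mass_eq_of_right_mass_eq hφc hm (hφtot.trans hmtot.symm) hright
  have hgy := hgmem y hyI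
  have hed := min_le_of_mass_eq (inv_pos.2 hC₁0) hcupos.le hp.le hm hφc hm0 hmlow hφup hgy hyI
    hright.symm hleft.symm
  have hde := min_le_of_mass_eq hclpos hC₁0.le hp.le hφc hm hφ0 hφlow hmup hyI hgy hright hleft
  have hag : a < g y := hga ▸ hg (left_mem_Icc.2 (by linarith)) hyI hy.1
  have hgb' : g y < b := by
    have := hg hyI (right_mem_Icc.2 (by linarith)) hy.2
    rwa [hgb] at this
  have hepos : 0 < min (g y - a) (b - g y) := lt_min (by linarith) (by linarith)
  have hdpos : 0 < min (y - -R) (R - y) := lt_min (by linarith [hy.1]) (by linarith [hy.2])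
  have h1 := hφlow y hyI
  have h2 := hφup y hyI
  have h3 := hmlow _ hgy
  have h4 := hmup _ hgy
  have h5 := hpush y hy
  set e := min (g y - a) (b - g y)
  set d := min (y - -R) (R - y)
  have hedp : e ^ p ≤ K ^ p * d ^ p := by
    rw [← Real.mul_rpow hKpos.le hdpos.le]
    exact Real.rpow_le_rpow hepos.le hed hp.le
  have hdep : d ^ p ≤ K' ^ p * e ^ p := by
    rw [← Real.mul_rpow hKpos'.le hepos.le]
    exact Real.rpow_le_rpow hdpos.le hde hp.le
  have hep : 0 < e ^ p := Real.rpow_pos_of_pos hepos p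
  have hdp : 0 < d ^ p := Real.rpow_pos_of_pos hdpos p
  have hmpos : 0 < mT (g y) := lt_of_lt_of_le (by positivity) h3
  have hg' : g' y = φ y / mT (g y) := by rw [← h5, mul_div_cancel_right₀ _ hmpos.ne']
  constructor
  · have hlow : (C₁ * K ^ p / cl)⁻¹ ≤ g' y := by
      rw [hg', inv_div, div_le_div_iff₀ (by positivity) hmpos]
      calc cl * mT (g y) ≤ cl * (C₁ * (K ^ p * d ^ p)) := by
            gcongr
            exact h4.trans (by gcongr)
        _ = cl * d ^ p * (C₁ * K ^ p) := by ring
        _ ≤ φ y * (C₁ * K ^ p) := by gcongr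
    exact (inv_anti₀ (by positivity) ((le_max_right _ _).trans (le_max_right _ _))).trans hlow
  · have hup : g' y ≤ cu * C₁ * K' ^ p := by
      rw [hg', div_le_iff₀ hmpos]
      calc φ y ≤ cu * (K' ^ p * e ^ p) := h2.trans (by gcongr)
        _ = cu * C₁ * K' ^ p * (C₁⁻¹ * e ^ p) := by field_simp
        _ ≤ cu * C₁ * K' ^ p * mT (g y) := by gcongr
    exact hup.trans ((le_max_left _ _).trans (le_max_right _ _))
end

section
/- Let θ>0, α := 2/(2+θ), and let R_α, φ be as in the context; write P(y) := φ(y)^θ = (1/2)α(1−α)(R_α²−y²) for y∈(−R_α,R_α), so that P'(y) = −α(1−α)y and P''(y) = −α(1−α). Let T>0, C₀ ≥ 1, ε ∈ (0,1), and let v : [0,T]×(−R_α,R_α) → (0,∞) be continuous and bounded, twice continuously differentiable on (0,T)×(−R_α,R_α), and suppose that at every point of (0,T)×(−R_α,R_α): ∂_{tt}v + (2θ+1)·P'(y)·∂_y v / v^{2+θ} + θ·P(y)·∂_{yy}v / v^{2+θ} − (2+θ)·θ·P(y)·(∂_y v)² / v^{3+θ} + α(1−α)/v^{θ+1} = 0.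 Assume moreover v(0,y) = ε^{α} and v(T,y) ≤ C₀ for all y ∈ (−R_α,R_α). Then there exists k>0, depending only on θ, T, C₀ (and not on ε or v), such that v(t,y) ≤ k·(t+ε)^{α} for all (t,y) ∈ [0,T]×(−R_α,R_α). -/
open MeasureTheory Set

/-- Necessary second order condition at a local maximum. -/
lemma IsLocalMax.second_deriv_nonpos {f f₁ : ℝ → ℝ} {f₂ x : ℝ}
    (hf : ∀ᶠ t in nhds x, HasDerivAt f (f₁ t) t) (hf₁ : HasDerivAt f₁ f₂ x)
    (hmax : IsLocalMax f x) : f₁ x = 0 ∧ f₂ ≤ 0 := by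
  have h0 : f₁ x = 0 := hmax.hasDerivAt_eq_zero hf.self_of_nhds
  refine ⟨h0, ?_⟩
  by_contra! hpos
  have hd : deriv f =ᶠ[nhds x] f₁ := hf.mono fun t ht => ht.deriv
  have hdd : deriv (deriv f) x = f₂ := hd.deriv_eq.trans hf₁.deriv
  have hmin : IsLocalMin f x :=
    isLocalMin_of_deriv_deriv_pos (hdd.symm ▸ hpos) (hd.self_of_nhds.trans h0)
      hf.self_of_nhds.continuousAt
  have hconst : f =ᶠ[nhds x] fun _ => f x := by
    filter_upwards [hmax, hmin] with t h1 h2 using le_antisymm h1 h2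
  have h1 : f₁ =ᶠ[nhds x] fun _ => 0 := by
    filter_upwards [hconst.eventuallyEq_nhds, hd] with t ht ht'
    rw [← ht', ht.deriv_eq, deriv_const]
  have h2 : f₂ = 0 := by rw [← hf₁.deriv, h1.deriv_eq, deriv_const]
  exact hpos.ne' h2

/-- First and second order conditions at a local maximum of `log w + g`. -/
lemma IsLocalMax.log_add_second_deriv {w w₁ g g₁ : ℝ → ℝ} {w₂ g₂ x : ℝ}
    (hw : ∀ᶠ t in nhds x, HasDerivAt w (w₁ t) t) (hw₁ : HasDerivAt w₁ w₂ x) (hpos : 0 < w x)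
    (hg : ∀ᶠ t in nhds x, HasDerivAt g (g₁ t) t) (hg₁ : HasDerivAt g₁ g₂ x)
    (hmax : IsLocalMax (fun t => Real.log (w t) + g t) x) :
    w₁ x / w x = -g₁ x ∧ w₂ / w x ≤ (g₁ x) ^ 2 - g₂ := by
  have hwx : ∀ᶠ t in nhds x, 0 < w t :=
    hw.self_of_nhds.continuousAt.eventually_const_lt hpos
  have key := IsLocalMax.second_deriv_nonpos (f := fun t => Real.log (w t) + g t)
    (f₁ := fun t => w₁ t / w t + g₁ t)
    (by
      filter_upwards [hw, hg, hwx] with t h1 h2 h3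
      exact (h1.log h3.ne').add h2)
    ((hw₁.div hw.self_of_nhds hpos.ne').add hg₁) hmax
  obtain ⟨h1, h2⟩ := key
  have h3 : w₁ x / w x = -g₁ x := by linarith
  refine ⟨h3, ?_⟩
  have h4 : (w₂ * w x - w₁ x * w₁ x) / w x ^ 2 = w₂ / w x - (w₁ x / w x) ^ 2 := by
    field_simp
  rw [h4, h3] at h2
  linarith [neg_sq (g₁ x)]

lemma ContDiffOn.eventually_hasDerivAt_deriv {f : ℝ → ℝ} {s : Set ℝ} {x : ℝ}
    (hf : ContDiffOn ℝ 2 f s) (hs : IsOpen s) (hx : x ∈ s) :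
    (∀ᶠ t in nhds x, HasDerivAt f (deriv f t) t) ∧
      HasDerivAt (deriv f) (deriv (deriv f) x) x := by
  constructor
  · filter_upwards [hs.mem_nhds hx] with t ht
    exact ((hf.differentiableOn (by norm_num)).differentiableAt (hs.mem_nhds ht)).hasDerivAt
  · have h : ContDiffOn ℝ 1 (deriv f) s := hf.deriv_of_isOpen hs (by norm_num)
    exact ((h.differentiableOn (by norm_num)).differentiableAt (hs.mem_nhds hx)).hasDerivAt

/-- The cutoff `1 - δ / (R² - y²)` and its first two derivatives. -/
lemma hasDerivAt_one_sub_div_sq_sub_sq (δ R y : ℝ) (hy : R ^ 2 - y ^ 2 ≠ 0) :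
    HasDerivAt (fun y => 1 - δ / (R ^ 2 - y ^ 2)) (-(δ * (2 * y)) / (R ^ 2 - y ^ 2) ^ 2) y ∧
    HasDerivAt (fun y => -(δ * (2 * y)) / (R ^ 2 - y ^ 2) ^ 2)
      (-(δ * 2) / (R ^ 2 - y ^ 2) ^ 2 - 8 * δ * y ^ 2 / (R ^ 2 - y ^ 2) ^ 3) y := by
  have hs : HasDerivAt (fun y : ℝ => R ^ 2 - y ^ 2) (-(2 * y)) y := by
    simpa using (hasDerivAt_pow 2 y).const_sub (R ^ 2)
  constructor
  · have h := ((hasDerivAt_const y δ).div hs hy).const_sub 1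
    refine h.congr_deriv ?_
    field_simp
    ring
  · have hn : HasDerivAt (fun y : ℝ => -(δ * (2 * y))) (-(δ * 2)) y := by
      simpa using (((hasDerivAt_id y).const_mul 2).const_mul δ).fun_neg
    have h := hn.div (hs.pow 2) (pow_ne_zero 2 hy)
    refine h.congr_deriv ?_
    simp only [Pi.pow_apply]
    field_simp
    ring

/-- The equation is incompatible with the second order conditions of a maximum of
`v ^ (1+θ) * z` relative to the self-similar barrier. -/
lemma planning_equation_contradiction {θ A R δ y s z V Vtt V₁ V₂ τ : ℝ} (hθ : 0 < θ) (hA : 0 < A)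
    (hR : 0 < R) (hδ : 0 < δ) (hδR : δ * (θ + 2) ^ 2 ≤ 8 * R ^ 2)
    (hs : s = R ^ 2 - y ^ 2) (hs0 : 0 < s) (hz : z = 1 - δ / s) (hz0 : 0 < z)
    (hV : 0 < V) (hτ : 0 < τ)
    (hW : 2 * τ ^ 2 < V ^ (2 + θ) * z)
    (ht : Vtt / V ≤ -A / τ ^ 2)
    (h₁ : V₁ / V = -(1 / (1 + θ) * ((-(δ * (2 * y)) / s ^ 2) / z)))
    (h₂ : V₂ / V ≤ (2 + θ) * (V₁ / V) ^ 2
      - 1 / (1 + θ) * ((-(δ * 2) / s ^ 2 - 8 * δ * y ^ 2 / s ^ 3) / z))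
    (heq : Vtt + (2*θ+1) * (-(A*y)) * V₁ / V ^ (2+θ) + θ * (A / 2 * s) * V₂ / V ^ (2+θ)
      - (2+θ) * θ * (A / 2 * s) * V₁ ^ 2 / V ^ (3+θ) + A / V ^ (θ+1) = 0) : False := by
  set W := V ^ (2 + θ) with hWdef
  have hW0 : 0 < W := Real.rpow_pos_of_pos hV _
  have e3 : V ^ (3 + θ) = W * V := by
    rw [hWdef, ← Real.rpow_add_one hV.ne']; ring_nf
  have e1 : V ^ (θ + 1) = W / V := by
    rw [hWdef, ← Real.rpow_sub_one hV.ne']; ring_nf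
  rw [e3, e1] at heq
  have hE : W * (Vtt / V) - (2*θ+1) * A * y * (V₁ / V)
      + θ * (A / 2 * s) * (V₂ / V - (2+θ) * (V₁ / V) ^ 2) + A = 0 := by
    rw [← mul_zero (W / V), ← heq]
    field_simp
    ring
  have b1 : W * (Vtt / V) ≤ W * (-A / τ ^ 2) := by gcongr
  have b2 : θ * (A / 2 * s) * (V₂ / V - (2+θ) * (V₁ / V) ^ 2) ≤ θ * (A / 2 * s) *
      (- (1 / (1 + θ) * ((-(δ * 2) / s ^ 2 - 8 * δ * y ^ 2 / s ^ 3) / z))) := by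
    gcongr
    linarith
  have b3 : W * (-A / τ ^ 2) * z ≤ -2 * A := by
    have : W * (-A / τ ^ 2) * z = -(A * (W * z)) / τ ^ 2 := by ring
    rw [this, div_le_iff₀ (by positivity)]
    nlinarith
  have hz1 : z < 1 := by rw [hz]; linarith [div_pos hδ hs0]
  have b4 : 0 ≤ W * (-A / τ ^ 2) - (2*θ+1) * A * y * (V₁ / V) + θ * (A / 2 * s) *
      (- (1 / (1 + θ) * ((-(δ * 2) / s ^ 2 - 8 * δ * y ^ 2 / s ^ 3) / z))) + A := by linarith
  rw [h₁] at b4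
  have b5 := mul_nonneg b4 hz0.le
  have hX : δ * ((θ + 2) * s - 2 * R ^ 2) / s ^ 2 ≤ 1 := by
    rw [div_le_one (by positivity)]
    have : 8 * R ^ 2 * (δ * ((θ + 2) * s - 2 * R ^ 2)) ≤ 8 * R ^ 2 * s ^ 2 := by
      nlinarith [mul_nonneg hδ.le (sq_nonneg ((θ + 2) * s - 4 * R ^ 2)),
        mul_le_mul_of_nonneg_right hδR (sq_nonneg s)]
    exact le_of_mul_le_mul_left this (by positivity)
  have e5 : (W * (-A / τ ^ 2) - (2*θ+1) * A * y *
        (-(1 / (1 + θ) * ((-(δ * (2 * y)) / s ^ 2) / z))) + θ * (A / 2 * s) *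
      (- (1 / (1 + θ) * ((-(δ * 2) / s ^ 2 - 8 * δ * y ^ 2 / s ^ 3) / z))) + A) * z
      = W * (-A / τ ^ 2) * z + A * z
        + A / (1 + θ) * (δ * ((θ + 2) * s - 2 * R ^ 2) / s ^ 2) := by
    have hy2 : R ^ 2 = s + y ^ 2 := by rw [hs]; ring
    rw [hy2]
    generalize W * (-A / τ ^ 2) = B
    clear * - hs0 hz0 hθ
    field_simp
    ring
  rw [e5] at b5
  have b6 : A / (1 + θ) * (δ * ((θ + 2) * s - 2 * R ^ 2) / s ^ 2) ≤ A / (1 + θ) * 1 := by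
    gcongr
  have b7 : A / (1 + θ) < A := div_lt_self hA (by linarith)
  have b8 : A * z < A := mul_lt_of_lt_one_right hA hz1
  linarith

lemma isLocalMax_log_add {θ : ℝ} (hθ : 0 < θ) {ρ z : ℝ → ℝ} {x : ℝ}
    (h : IsLocalMax (fun t => (ρ t) ^ (1 + θ) * z t) x)
    (hρ : ∀ᶠ t in nhds x, 0 < ρ t) (hz : ∀ᶠ t in nhds x, 0 < z t) :
    IsLocalMax (fun t => Real.log (ρ t) + 1 / (1 + θ) * Real.log (z t)) x := by
  have e : ∀ t, 0 < ρ t → 0 < z t → Real.log (ρ t) + 1 / (1 + θ) * Real.log (z t)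
      = 1 / (1 + θ) * Real.log ((ρ t) ^ (1 + θ) * z t) := by
    intro t h1 h2
    rw [Real.log_mul (Real.rpow_pos_of_pos h1 _).ne' h2.ne', Real.log_rpow h1]
    field_simp
  filter_upwards [h, hρ, hz] with t h1 h2 h3
  rw [e t h2 h3, e x hρ.self_of_nhds hz.self_of_nhds]
  have := Real.rpow_pos_of_pos h2 (1 + θ)
  gcongr

/-- Comparison with the self-similar barrier, localized by a cutoff vanishing where
`R² - y² = δ`. -/
lemma planning_cutoff_bound {θ α R T ε δ k : ℝ} (hθ : 0 < θ) (hα : α = 2 / (2 + θ))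
    (hR : 0 < R) (hT : 0 < T) (hε : 0 < ε) (hδ : 0 < δ) (hδR : δ * (θ + 2) ^ 2 ≤ 8 * R ^ 2)
    (hk : 2 ≤ k) {v : ℝ → ℝ → ℝ}
    (hcont : ContinuousOn (fun p : ℝ × ℝ => v p.1 p.2) (Icc 0 T ×ˢ Ioo (-R) R))
    (hpos : ∀ t ∈ Icc 0 T, ∀ y ∈ Ioo (-R) R, 0 < v t y)
    (hC2 : ContDiffOn ℝ 2 (fun p : ℝ × ℝ => v p.1 p.2) (Ioo 0 T ×ˢ Ioo (-R) R))
    (heq : ∀ t ∈ Ioo 0 T, ∀ y ∈ Ioo (-R) R,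
        deriv (deriv (fun s => v s y)) t
          + (2*θ+1) * (-(α*(1-α)*y)) * deriv (fun z => v t z) y / (v t y) ^ (2+θ)
          + θ * ((1/2)*α*(1-α)*(R^2 - y^2)) * deriv (deriv (fun z => v t z)) y
              / (v t y) ^ (2+θ)
          - (2+θ) * θ * ((1/2)*α*(1-α)*(R^2 - y^2)) * (deriv (fun z => v t z) y)^2
              / (v t y) ^ (3+θ)
          + α*(1-α) / (v t y) ^ (θ+1) = 0)
    (h0 : ∀ y ∈ Ioo (-R) R, v 0 y ≤ k * (0 + ε) ^ α)
    (h1 : ∀ y ∈ Ioo (-R) R, v T y ≤ k * (T + ε) ^ α)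
    {t y : ℝ} (ht : t ∈ Icc 0 T) (hy : δ ≤ R ^ 2 - y ^ 2) :
    (v t y / (t + ε) ^ α) ^ (1 + θ) * (1 - δ / (R ^ 2 - y ^ 2)) ≤ k ^ (1 + θ) := by
  have hA : 0 < α * (1 - α) := by
    have : α < 1 := by rw [hα, div_lt_one (by linarith)]; linarith
    have : 0 < α := by rw [hα]; positivity
    exact mul_pos this (by linarith)
  set F : ℝ × ℝ → ℝ := fun p =>
    (v p.1 p.2 / (p.1 + ε) ^ α) ^ (1 + θ) * (1 - δ / (R ^ 2 - p.2 ^ 2)) with hF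
  set S : Set ℝ := {y | δ ≤ R ^ 2 - y ^ 2} with hS
  have hSsub : ∀ y ∈ S, y ∈ Ioo (-R) R := fun y hy => by
    simp only [hS, mem_ofPred_eq] at hy
    exact abs_lt.1 (abs_lt_of_sq_lt_sq (by linarith) hR.le)
  have hScpt : IsCompact S := by
    refine Metric.isCompact_of_isClosed_isBounded
      (isClosed_le continuous_const (by fun_prop)) ?_
    exact (Metric.isBounded_Icc (-R) R).subset fun y hy => Ioo_subset_Icc_self (hSsub y hy)
  have hFc : ContinuousOn F (Icc 0 T ×ˢ S) := by
    have hτ : ∀ p ∈ Icc 0 T ×ˢ S, p.1 + ε ≠ 0 := fun p hp => by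
      have := hp.1.1; positivity
    refine ContinuousOn.mul (ContinuousOn.rpow_const (ContinuousOn.div
      (hcont.mono (prod_mono_right hSsub)) (ContinuousOn.rpow_const (by fun_prop) ?_) ?_) ?_) ?_
    · exact fun p hp => Or.inl (hτ p hp)
    · intro p hp
      have := hp.1.1
      positivity
    · exact fun p hp => Or.inr (by linarith)
    · refine continuousOn_const.sub (continuousOn_const.div (by fun_prop) ?_)
      intro p hp
      have : δ ≤ R ^ 2 - p.2 ^ 2 := hp.2
      linarith
  obtain ⟨⟨t₀, y₀⟩, hmem, hmaxOn⟩ := (isCompact_Icc.prod hScpt).exists_isMaxOn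
    ⟨(t, y), ht, hy⟩ hFc
  refine (hmaxOn (a := (t, y)) ⟨ht, hy⟩ : F (t, y) ≤ F (t₀, y₀)).trans ?_
  by_contra! hlt
  obtain ⟨ht₀, hy₀S⟩ := hmem
  simp only at ht₀ hy₀S
  have hy₀ := hSsub y₀ hy₀S
  have hs0 : 0 < R ^ 2 - y₀ ^ 2 := lt_of_lt_of_le hδ hy₀S
  have hτ : 0 < t₀ + ε := by linarith [ht₀.1]
  have hV := hpos t₀ ht₀ y₀ hy₀
  have hτα : 0 < (t₀ + ε) ^ α := Real.rpow_pos_of_pos hτ _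
  set ρ := v t₀ y₀ / (t₀ + ε) ^ α with hρ
  set z := 1 - δ / (R ^ 2 - y₀ ^ 2) with hz
  have hlt' : k ^ (1 + θ) < ρ ^ (1 + θ) * z := hlt
  have hρ0 : 0 < ρ := div_pos hV hτα
  have hρp : 0 < ρ ^ (1 + θ) := Real.rpow_pos_of_pos hρ0 _
  have hkp : 1 ≤ k ^ (1 + θ) := Real.one_le_rpow (by linarith) (by linarith)
  have hz0 : 0 < z := pos_of_mul_pos_right (by linarith) hρp.le
  have hz1 : z ≤ 1 := by linarith [div_pos hδ hs0]
  have hkρ : k < ρ := by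
    have : k ^ (1 + θ) < ρ ^ (1 + θ) := by nlinarith
    exact (Real.rpow_lt_rpow_iff (by linarith) hρ0.le (by linarith)).1 this
  have hvgt : k * (t₀ + ε) ^ α < v t₀ y₀ := (lt_div_iff₀ hτα).1 hkρ
  have ht₀' : t₀ ∈ Ioo 0 T := by
    refine ⟨lt_of_le_of_ne ht₀.1 ?_, lt_of_le_of_ne ht₀.2 ?_⟩
    · rintro rfl
      exact absurd hvgt (not_lt.2 (h0 y₀ hy₀))
    · rintro rfl
      exact absurd hvgt (not_lt.2 (h1 y₀ hy₀))
  -- second order conditions in `t`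
  have hct : ContDiffOn ℝ 2 (fun s => v s y₀) (Ioo 0 T) :=
    hC2.comp (f := fun s : ℝ => (s, y₀)) (by fun_prop) fun s hs => ⟨hs, hy₀⟩
  obtain ⟨dt1, dt2⟩ := hct.eventually_hasDerivAt_deriv isOpen_Ioo ht₀'
  have hmt : IsLocalMax (fun s => (v s y₀ / (s + ε) ^ α) ^ (1 + θ) * z) t₀ := by
    filter_upwards [isOpen_Ioo.mem_nhds ht₀'] with s hs
    exact hmaxOn (a := (s, y₀)) ⟨Ioo_subset_Icc_self hs, hy₀S⟩
  have hmt' := isLocalMax_log_add hθ hmt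
    (by
      filter_upwards [isOpen_Ioo.mem_nhds ht₀'] with s hs
      exact div_pos (hpos s (Ioo_subset_Icc_self hs) y₀ hy₀)
        (Real.rpow_pos_of_pos (by linarith [hs.1]) _))
    (Filter.Eventually.of_forall fun _ => hz0)
  have hmt'' : IsLocalMax (fun s => Real.log (v s y₀) +
      (-(α * Real.log (s + ε)) + 1 / (1 + θ) * Real.log z)) t₀ := by
    refine hmt'.congr ?_
    filter_upwards [isOpen_Ioo.mem_nhds ht₀'] with s hs
    have hs' : 0 < s + ε := by linarith [hs.1]
    rw [Real.log_div (hpos s (Ioo_subset_Icc_self hs) y₀ hy₀).ne'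
      (Real.rpow_pos_of_pos hs' _).ne', Real.log_rpow hs']
    ring
  have ct := (hmt''.log_add_second_deriv dt1 dt2 hV (g₁ := fun s => -(α * (1 / (s + ε))))
    (g₂ := α / (t₀ + ε) ^ 2)
    (by
      filter_upwards [isOpen_Ioo.mem_nhds ht₀'] with s hs
      have hs' : s + ε ≠ 0 := by linarith [hs.1]
      exact ((((hasDerivAt_id s).add_const ε).log hs').const_mul α).neg.add_const _)
    (by
      have h := ((((hasDerivAt_const t₀ (1:ℝ)).div
        ((hasDerivAt_id t₀).add_const ε) hτ.ne').const_mul α)).neg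
      refine h.congr_deriv ?_
      simp
      ring)).2
  -- second order conditions in `y`
  have hcy : ContDiffOn ℝ 2 (fun x => v t₀ x) (Ioo (-R) R) :=
    hC2.comp (f := fun x : ℝ => (t₀, x)) (by fun_prop) fun x hx => ⟨ht₀', hx⟩
  obtain ⟨dy1, dy2⟩ := hcy.eventually_hasDerivAt_deriv isOpen_Ioo hy₀
  have hnear : ∀ᶠ x in nhds y₀, x ∈ Ioo (-R) R ∧ δ < R ^ 2 - x ^ 2 := by
    refine (isOpen_Ioo.eventually_mem hy₀).and ?_
    have : δ < R ^ 2 - y₀ ^ 2 := by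
      have : δ / (R ^ 2 - y₀ ^ 2) < 1 := by linarith
      rwa [div_lt_one hs0] at this
    exact (by fun_prop : Continuous fun x : ℝ => R ^ 2 - x ^ 2).continuousAt.eventually_const_lt
      this
  have hzx : ∀ x, δ < R ^ 2 - x ^ 2 → 0 < 1 - δ / (R ^ 2 - x ^ 2) := fun x hx => by
    have := (div_lt_one (hδ.trans hx)).2 hx
    linarith
  have hmy : IsLocalMax (fun x => (v t₀ x / (t₀ + ε) ^ α) ^ (1 + θ) *
      (1 - δ / (R ^ 2 - x ^ 2))) y₀ := by
    filter_upwards [hnear] with x hx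
    exact hmaxOn (a := (t₀, x)) ⟨ht₀, hx.2.le⟩
  have hmy' := isLocalMax_log_add hθ hmy
    (by
      filter_upwards [hnear] with x hx
      exact div_pos (hpos t₀ ht₀ x hx.1) hτα)
    (by
      filter_upwards [hnear] with x hx using hzx x hx.2)
  have hmy'' : IsLocalMax (fun x => Real.log (v t₀ x) +
      (1 / (1 + θ) * Real.log (1 - δ / (R ^ 2 - x ^ 2)) - Real.log ((t₀ + ε) ^ α))) y₀ := by
    refine hmy'.congr ?_
    filter_upwards [hnear] with x hx
    rw [Real.log_div (hpos t₀ ht₀ x hx.1).ne' hτα.ne']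
    ring
  obtain ⟨z1, z2⟩ := hasDerivAt_one_sub_div_sq_sub_sq δ R y₀ hs0.ne'
  obtain ⟨cy1, cy2⟩ := hmy''.log_add_second_deriv dy1 dy2 hV
    (by
      filter_upwards [hnear] with x hx
      exact (((hasDerivAt_one_sub_div_sq_sub_sq δ R x (hδ.trans hx.2).ne').1.log
        (hzx x hx.2).ne').const_mul (1 / (1 + θ))).sub_const _)
    ((z2.div z1 hz0.ne').const_mul (1 / (1 + θ)))
  simp only [Pi.div_apply, ← hz] at cy1 cy2
  refine planning_equation_contradiction (A := α * (1 - α)) (τ := t₀ + ε) hθ hA hR hδ hδR rfl hs0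
    hz hz0 hV hτ ?_ ?_ cy1 ?_ ?_ (Vtt := deriv (deriv fun s => v s y₀) t₀)
    (V₂ := deriv (deriv fun x => v t₀ x) y₀)
  · have e1 : v t₀ y₀ = ρ * (t₀ + ε) ^ α := by rw [hρ]; field_simp
    have e2 : ((t₀ + ε) ^ α) ^ (2 + θ) = (t₀ + ε) ^ 2 := by
      rw [← Real.rpow_mul hτ.le, ← Real.rpow_natCast]
      congr 1
      rw [hα]
      field_simp
      norm_num
    have e3 : ρ ^ (2 + θ) = ρ ^ (1 + θ) * ρ := by
      rw [← Real.rpow_add_one hρ0.ne']; ring_nf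
    rw [e1, Real.mul_rpow hρ0.le hτα.le, e2, e3]
    have : 2 < ρ ^ (1 + θ) * ρ * z := by nlinarith
    nlinarith [pow_pos hτ 2]
  · refine ct.trans (le_of_eq ?_)
    field_simp
    ring
  · rw [cy1]
    refine cy2.trans (le_of_eq ?_)
    clear_value z
    clear * - hs0 hz0 hθ
    field_simp
    ring
  · rw [← heq t₀ ht₀' y₀ hy₀]
    ring

/-- comparison-principle upper bound v(t,y) ≤ k(t+ε)^α for positive
bounded solutions of the PDE satisfied by the space derivative of the rescaled
Lagrangian flow, with k depending only on θ, T, C₀ (not on ε or v). -/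
theorem stmt_6 (θ : ℝ) (hθ : 0 < θ)
    (α : ℝ) (hα : α = 2 / (2 + θ))
    (R : ℝ) (hR : 0 < R)
    (φ : ℝ → ℝ)
    (hφ : ∀ r, φ r = (max ((1/2) * α * (1 - α) * (R^2 - r^2)) 0) ^ (1/θ))
    (hφint : (∫ r : ℝ, φ r) = 1)
    (T C₀ : ℝ) (hT : 0 < T) (hC₀ : 1 ≤ C₀) :
    ∃ k > 0, ∀ ε ∈ Ioo (0:ℝ) 1, ∀ v : ℝ → ℝ → ℝ,
      ContinuousOn (fun p : ℝ × ℝ => v p.1 p.2) (Icc 0 T ×ˢ Ioo (-R) R) →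
      (∃ M, ∀ t ∈ Icc 0 T, ∀ y ∈ Ioo (-R) R, v t y ≤ M) →
      (∀ t ∈ Icc 0 T, ∀ y ∈ Ioo (-R) R, 0 < v t y) →
      ContDiffOn ℝ 2 (fun p : ℝ × ℝ => v p.1 p.2) (Ioo 0 T ×ˢ Ioo (-R) R) →
      (∀ t ∈ Ioo 0 T, ∀ y ∈ Ioo (-R) R,
        deriv (deriv (fun s => v s y)) t
          + (2*θ+1) * (-(α*(1-α)*y)) * deriv (fun z => v t z) y / (v t y) ^ (2+θ)
          + θ * ((1/2)*α*(1-α)*(R^2 - y^2)) * deriv (deriv (fun z => v t z)) y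
              / (v t y) ^ (2+θ)
          - (2+θ) * θ * ((1/2)*α*(1-α)*(R^2 - y^2)) * (deriv (fun z => v t z) y)^2
              / (v t y) ^ (3+θ)
          + α*(1-α) / (v t y) ^ (θ+1) = 0) →
      (∀ y ∈ Ioo (-R) R, v 0 y = ε ^ α) →
      (∀ y ∈ Ioo (-R) R, v T y ≤ C₀) →
      ∀ t ∈ Icc 0 T, ∀ y ∈ Ioo (-R) R, v t y ≤ k * (t + ε) ^ α := by
  have hα0 : 0 < α := by rw [hα]; positivity
  have hTα : 0 < T ^ α := Real.rpow_pos_of_pos hT _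
  have hCT : 0 < C₀ / T ^ α := by positivity
  refine ⟨2 + C₀ / T ^ α, by positivity, ?_⟩
  intro ε hε v hcont _ hpos hC2 heq h0 h1 t ht y hy
  set k := 2 + C₀ / T ^ α with hk
  have hε0 : 0 < ε := hε.1
  have hs0 : 0 < R ^ 2 - y ^ 2 := by nlinarith [hy.1, hy.2]
  have hτα : 0 < (t + ε) ^ α := Real.rpow_pos_of_pos (by linarith [ht.1]) _
  have h0' : ∀ y ∈ Ioo (-R) R, v 0 y ≤ k * (0 + ε) ^ α := fun y hy => by
    rw [h0 y hy, zero_add]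
    have := Real.rpow_pos_of_pos hε0 α
    nlinarith
  have h1' : ∀ y ∈ Ioo (-R) R, v T y ≤ k * (T + ε) ^ α := fun y hy => by
    have hmono : T ^ α ≤ (T + ε) ^ α := Real.rpow_le_rpow hT.le (by linarith) hα0.le
    calc v T y ≤ C₀ := h1 y hy
      _ = C₀ / T ^ α * T ^ α := by field_simp
      _ ≤ k * (T + ε) ^ α := by gcongr; linarith
  have hbound : ∀ᶠ δ in nhdsWithin (0:ℝ) (Ioi 0),
      (v t y / (t + ε) ^ α) ^ (1 + θ) * (1 - δ / (R ^ 2 - y ^ 2)) ≤ k ^ (1 + θ) := by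
    filter_upwards [Ioo_mem_nhdsGT (show (0:ℝ) < min (R ^ 2 - y ^ 2) (8 * R ^ 2 / (θ + 2) ^ 2) from
      lt_min hs0 (by positivity))] with δ hδ
    have hδ2 : δ * (θ + 2) ^ 2 ≤ 8 * R ^ 2 :=
      (le_div_iff₀ (by positivity)).1 (hδ.2.le.trans (min_le_right _ _))
    exact planning_cutoff_bound hθ hα hR hT hε0 hδ.1 hδ2 (by linarith) hcont hpos hC2 heq h0' h1'
      ht (hδ.2.le.trans (min_le_left _ _))
  have hlim : Filter.Tendsto
      (fun δ : ℝ => (v t y / (t + ε) ^ α) ^ (1 + θ) * (1 - δ / (R ^ 2 - y ^ 2)))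
      (nhdsWithin 0 (Ioi 0)) (nhds ((v t y / (t + ε) ^ α) ^ (1 + θ))) := by
    have : Continuous
        (fun δ : ℝ => (v t y / (t + ε) ^ α) ^ (1 + θ) * (1 - δ / (R ^ 2 - y ^ 2))) := by fun_prop
    simpa using (this.tendsto 0).mono_left nhdsWithin_le_nhds
  have hle := le_of_tendsto hlim hbound
  rw [Real.rpow_le_rpow_iff (div_pos (hpos t ht y hy) hτα).le (by linarith) (by linarith),
    div_le_iff₀ hτα] at hle
  exact hle
end

section
/- Let α ∈ (0,1), R>0, T>0, ε ∈ (0,1), C>0 and a<b be real numbers. Let γ : [0,T]×[−R,R] → ℝ satisfy: (i) for each t, y ↦ γ(t,y) is nondecreasing; (ii) t ↦ γ(t,−R) is convex and t ↦ γ(t,R) is concave; (iii) γ(0,−R) = −R ε^{α}, γ(0,R) = R ε^{α}, γ(T,−R) = a, γ(T,R) = b; (iv) γ(t,R) − γ(t,−R) ≤ C (t+ε)^{α} for all t ∈ [0,T]. Then there exists C'>0, depending only on C, a, b, T, R, α, such that |γ(t,y)| ≤ C'(ε+t)^{α} for all (t,y) ∈ [0,T]×[−R,R]. -/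
open Set

/-- sharp bound |γ(t,y)| ≤ C'(ε+t)^α on the support of the density,
from monotonicity, convexity/concavity of the free boundary curves, endpoint values
and the width bound, with C' depending only on C, a, b, T, R, α. -/
theorem stmt_7 (α : ℝ) (hα : α ∈ Ioo (0:ℝ) 1)
    (R T C a b : ℝ) (hR : 0 < R) (hT : 0 < T) (hC : 0 < C) (hab : a < b) :
    ∃ C' > 0, ∀ ε ∈ Ioo (0:ℝ) 1, ∀ γ : ℝ → ℝ → ℝ,
      (∀ t ∈ Icc 0 T, MonotoneOn (fun y => γ t y) (Icc (-R) R)) →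
      ConvexOn ℝ (Icc 0 T) (fun t => γ t (-R)) →
      ConcaveOn ℝ (Icc 0 T) (fun t => γ t R) →
      γ 0 (-R) = -R * ε ^ α →
      γ 0 R = R * ε ^ α →
      γ T (-R) = a →
      γ T R = b →
      (∀ t ∈ Icc 0 T, γ t R - γ t (-R) ≤ C * (t + ε) ^ α) →
      ∀ t ∈ Icc 0 T, ∀ y ∈ Icc (-R) R, |γ t y| ≤ C' * (ε + t) ^ α := by
  obtain ⟨hα0, hα1⟩ := hα
  have hTα : 0 < T ^ α := Real.rpow_pos_of_pos hT α
  refine ⟨C + (|a| + |b|) / T ^ α, by positivity, ?_⟩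
  intro ε hε γ hmono hconv hconc h0l h0r hTl hTr hwidth t ht y hy
  obtain ⟨ht0, htT⟩ := ht
  have hs0 : 0 ≤ t / T := by positivity
  have hs1 : t / T ≤ 1 := (div_le_one hT).2 htT
  have hεα : 0 < ε ^ α := Real.rpow_pos_of_pos hε.1 α
  have hcomb : (1 - t / T) * 0 + t / T * T = t := by field_simp; ring
  have hl := hconv.2 (left_mem_Icc.2 hT.le) (right_mem_Icc.2 hT.le)
    (sub_nonneg.2 hs1) hs0 (sub_add_cancel 1 (t / T))
  have hr := hconc.2 (left_mem_Icc.2 hT.le) (right_mem_Icc.2 hT.le)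
    (sub_nonneg.2 hs1) hs0 (sub_add_cancel 1 (t / T))
  simp only [smul_eq_mul, hcomb, h0l, h0r, hTl, hTr] at hl hr
  have hRε : 0 ≤ (1 - t / T) * (R * ε ^ α) :=
    mul_nonneg (sub_nonneg.2 hs1) (by positivity)
  have hsa : t / T * a ≤ t / T * |a| := mul_le_mul_of_nonneg_left (le_abs_self a) hs0
  have hsb : t / T * (-|b|) ≤ t / T * b := mul_le_mul_of_nonneg_left (neg_abs_le b) hs0
  have hs : t / T ≤ (t + ε) ^ α / T ^ α :=
    calc t / T ≤ (t / T) ^ α := Real.self_le_rpow_of_le_one hs0 hs1 hα1.le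
      _ = t ^ α / T ^ α := Real.div_rpow ht0 hT.le α
      _ ≤ (t + ε) ^ α / T ^ α := by
        have := hε.1.le
        gcongr
        linarith
  have hka : t / T * |a| ≤ (t + ε) ^ α / T ^ α * |a| :=
    mul_le_mul_of_nonneg_right hs (abs_nonneg a)
  have hkb : t / T * |b| ≤ (t + ε) ^ α / T ^ α * |b| :=
    mul_le_mul_of_nonneg_right hs (abs_nonneg b)
  have hka0 : 0 ≤ (t + ε) ^ α / T ^ α * |a| := (mul_nonneg hs0 (abs_nonneg a)).trans hka
  have hkb0 : 0 ≤ (t + ε) ^ α / T ^ α * |b| := (mul_nonneg hs0 (abs_nonneg b)).trans hkb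
  have hw := hwidth t ⟨ht0, htT⟩
  have hRR : -R ≤ R := by linarith
  have hyl : γ t (-R) ≤ γ t y := hmono t ⟨ht0, htT⟩ (left_mem_Icc.2 hRR) hy hy.1
  have hyr : γ t y ≤ γ t R := hmono t ⟨ht0, htT⟩ hy (right_mem_Icc.2 hRR) hy.2
  have hK : (C + (|a| + |b|) / T ^ α) * (ε + t) ^ α =
      C * (t + ε) ^ α + (t + ε) ^ α / T ^ α * |a| + (t + ε) ^ α / T ^ α * |b| := by
    rw [add_comm ε t]; ring
  rw [hK, abs_le]
  constructor <;> linarith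
end

section
/- Let θ>0, α := 2/(2+θ), and let R_α, φ be as in the context. Let T>0, C₁ ≥ 1, ε ∈ (0,1). Let g : [0,T]×[−R_α,R_α] → (0,∞) be continuous, twice continuously differentiable on (0,T)×(−R_α,R_α), and suppose: (i) g(t,y) ≤ C₁(t+ε)^{α} for all (t,y); (ii) g(0,y) = ε^{α} and g(T,y) ≥ C₁^{−1} for all y ∈ (−R_α,R_α); (iii) the function v := φ^θ / g^θ, defined on [0,T]×(−R_α,R_α), satisfies at every point of (0,T)×(−R_α,R_α) the differential inequality −∂_{tt}v − (θ v / g²)·∂_{yy}v ≤ −(∂_y v / g²)·( (φ^θ)'(y)/g^θ − ∂_y v ), where (φ^θ)'(y) = −α(1−α)y. Then there exists C₂>0, depending only on θ, T, C₁ (and not on ε, g), such that g(t,y) ≥ C₂^{−1}(t+ε)^{α} for all (t,y) ∈ [0,T]×(−R_α,R_α). -/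
open MeasureTheory Set
open Filter Topology

/-- If `f ≤ h` near `x` with equality at `x`, the first derivatives agree at `x` and the second
derivatives are ordered. -/
theorem deriv_eq_and_deriv2_le_of_eventually_le {f h h' : ℝ → ℝ} {h'' x : ℝ}
    (hf : ContDiffAt ℝ 2 f x) (hh : ∀ᶠ y in 𝓝 x, HasDerivAt h (h' y) y)
    (hh' : HasDerivAt h' h'' x) (hle : ∀ᶠ y in 𝓝 x, f y ≤ h y) (heq : f x = h x) :
    deriv f x = h' x ∧ deriv (deriv f) x ≤ h'' := by
  have hd : ∀ᶠ y in 𝓝 x, HasDerivAt f (deriv f y) y := by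
    filter_upwards [hf.eventually (by simp)] with y hy
    exact (hy.differentiableAt (by norm_num)).hasDerivAt
  have hdd : HasDerivAt (deriv f) (deriv (deriv f) x) x := by
    have h1 : ContDiffAt ℝ 1 (deriv f) x :=
      (hf.fderiv_right (m := 1) (by norm_num)).clm_apply contDiffAt_const
    exact (h1.differentiableAt (by norm_num)).hasDerivAt
  set D : ℝ → ℝ := fun y => f y - h y with hD
  have hDd : ∀ᶠ y in 𝓝 x, HasDerivAt D (deriv f y - h' y) y := by
    filter_upwards [hd, hh] with y h1 h2
    exact h1.sub h2
  have hDmax : IsLocalMax D x := by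
    filter_upwards [hle] with y hy
    simp only [hD, heq]
    linarith
  have hD0 : deriv D x = 0 := hDmax.deriv_eq_zero
  have hDeq : deriv D =ᶠ[𝓝 x] fun y => deriv f y - h' y := by
    filter_upwards [hDd] with y hy using hy.deriv
  have hD2 : deriv (deriv D) x = deriv (deriv f) x - h'' := by
    rw [hDeq.deriv_eq]
    exact (hdd.sub hh').deriv
  refine ⟨by have := hDeq.self_of_nhds; simp only [hD0] at this; linarith, ?_⟩
  by_contra! hlt
  have hDmin : IsLocalMin D x := isLocalMin_of_deriv_deriv_pos (by rw [hD2]; linarith) hD0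
    hDd.self_of_nhds.continuousAt
  have hDc : D =ᶠ[𝓝 x] fun _ => D x := by
    filter_upwards [hDmax, hDmin] with y h1 h2 using le_antisymm h1 h2
  have : deriv (deriv D) x = 0 := by
    rw [hDc.deriv.deriv_eq]
    simp
  linarith

/-- A continuous function on a rectangle that is nonpositive on the four sides and positive
somewhere attains its maximum in the interior. -/
theorem exists_interior_max_of_boundary_nonpos {F : ℝ → ℝ → ℝ} {a b c d t₀ y₀ : ℝ}
    (hF : ContinuousOn (fun p : ℝ × ℝ => F p.1 p.2) (Icc a b ×ˢ Icc c d))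
    (ht₀ : t₀ ∈ Icc a b) (hy₀ : y₀ ∈ Icc c d) (hpos : 0 < F t₀ y₀)
    (ha : ∀ y ∈ Icc c d, F a y ≤ 0) (hb : ∀ y ∈ Icc c d, F b y ≤ 0)
    (hc : ∀ t ∈ Icc a b, F t c ≤ 0) (hd : ∀ t ∈ Icc a b, F t d ≤ 0) :
    ∃ t₁ ∈ Ioo a b, ∃ y₁ ∈ Ioo c d, 0 < F t₁ y₁ ∧
      ∀ t ∈ Icc a b, ∀ y ∈ Icc c d, F t y ≤ F t₁ y₁ := by
  obtain ⟨⟨t₁, y₁⟩, ⟨ht₁, hy₁⟩, hmax⟩ :=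
    (isCompact_Icc.prod isCompact_Icc).exists_isMaxOn ⟨(t₀, y₀), ht₀, hy₀⟩ hF
  have hmax' : ∀ t ∈ Icc a b, ∀ y ∈ Icc c d, F t y ≤ F t₁ y₁ :=
    fun t ht y hy => hmax (show (t, y) ∈ Icc a b ×ˢ Icc c d from ⟨ht, hy⟩)
  have h1 : 0 < F t₁ y₁ := hpos.trans_le (hmax' _ ht₀ _ hy₀)
  simp only at ht₁ hy₁
  refine ⟨t₁, ⟨ht₁.1.lt_of_ne ?_, ht₁.2.lt_of_ne ?_⟩, y₁,
    ⟨hy₁.1.lt_of_ne ?_, hy₁.2.lt_of_ne ?_⟩, h1, hmax'⟩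
  · rintro rfl; linarith [ha _ hy₁]
  · rintro rfl; linarith [hb _ hy₁]
  · rintro rfl; linarith [hc _ ht₁]
  · rintro rfl; linarith [hd _ ht₁]

/-- The inequality satisfied at a touching point of the barrier `P Z ^ r`, where `a = Z ^ r`, and
`W = ∂ₜₜ Z`. The first derivatives in space cancel because `θ (1 - r) = r`. -/
theorem barrier_touching_ineq {θ r k δ Z a P d G W vtt vy vyy : ℝ} (hθ : 0 < θ)
    (hr : r = θ / (θ + 1)) (hδ : 0 < δ) (hZ : 0 < Z) (ha : 0 < a) (hP : 0 < P) (hG : 0 < G)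
    (htt : vtt ≤ P * (r * (a / Z) * W))
    (hy : vy = d * (a - δ * r * (a / Z)))
    (hyy : vyy ≤ -k * (a - δ * r * (a / Z))
      - δ * (d ^ 2 / P) * (r * (a / Z) + δ * r * (1 - r) * (a / Z ^ 2)))
    (h : -vtt - (θ * (P * a) / G ^ 2) * vyy ≤ -(vy / G ^ 2) * (d * a - vy)) :
    θ * k * (Z - δ * r) * a ≤ r * G ^ 2 * W := by
  have hrpos : 0 < r := by rw [hr]; positivity
  have h1 : (θ * (P * a) / G ^ 2) * vyy ≤ (θ * (P * a) / G ^ 2) * (-k * (a - δ * r * (a / Z))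
      - δ * (d ^ 2 / P) * (r * (a / Z) + δ * r * (1 - r) * (a / Z ^ 2))) := by gcongr
  have h2 : 0 ≤ -(vy / G ^ 2) * (d * a - vy) + P * (r * (a / Z) * W)
      + (θ * (P * a) / G ^ 2) * (-k * (a - δ * r * (a / Z))
      - δ * (d ^ 2 / P) * (r * (a / Z) + δ * r * (1 - r) * (a / Z ^ 2))) := by linarith
  have h3 : -(vy / G ^ 2) * (d * a - vy) + P * (r * (a / Z) * W)
      + (θ * (P * a) / G ^ 2) * (-k * (a - δ * r * (a / Z))
      - δ * (d ^ 2 / P) * (r * (a / Z) + δ * r * (1 - r) * (a / Z ^ 2)))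
      = (P * a / (Z * G ^ 2)) * (r * G ^ 2 * W - θ * k * (Z - δ * r) * a)
        - δ * d ^ 2 * r * (θ + 1) * a ^ 2 / (Z * G ^ 2) := by
    rw [hy, hr]
    field_simp
    ring
  rw [h3] at h2
  have h4 : 0 ≤ δ * d ^ 2 * r * (θ + 1) * a ^ 2 / (Z * G ^ 2) := by positivity
  have h5 : 0 ≤ (P * a / (Z * G ^ 2)) * (r * G ^ 2 * W - θ * k * (Z - δ * r) * a) := by linarith
  have h6 := nonneg_of_mul_nonneg_right h5 (by positivity)
  linarith

/-- First and second derivatives of `m (c - δ log m) ^ r` for `m = κ (R² - y²)`. -/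
theorem hasDerivAt_logBarrier {κ R c δ r y : ℝ} (hκ : 0 < κ) (hy : y ∈ Ioo (-R) R)
    (hZ : 0 < c - δ * Real.log (R ^ 2 - y ^ 2)) :
    HasDerivAt (fun x => κ * (R ^ 2 - x ^ 2) * (c - δ * Real.log (R ^ 2 - x ^ 2)) ^ r)
      ((-2 * κ * y) * ((c - δ * Real.log (R ^ 2 - y ^ 2)) ^ r
        - δ * r * (c - δ * Real.log (R ^ 2 - y ^ 2)) ^ (r - 1))) y ∧
    HasDerivAt (fun x => (-2 * κ * x) * ((c - δ * Real.log (R ^ 2 - x ^ 2)) ^ r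
        - δ * r * (c - δ * Real.log (R ^ 2 - x ^ 2)) ^ (r - 1)))
      (-(2 * κ) * ((c - δ * Real.log (R ^ 2 - y ^ 2)) ^ r
          - δ * r * (c - δ * Real.log (R ^ 2 - y ^ 2)) ^ (r - 1))
        - δ * ((-2 * κ * y) ^ 2 / (κ * (R ^ 2 - y ^ 2)))
          * (r * (c - δ * Real.log (R ^ 2 - y ^ 2)) ^ (r - 1)
            + δ * r * (1 - r) * (c - δ * Real.log (R ^ 2 - y ^ 2)) ^ (r - 1 - 1))) y := by
  have hm : 0 < R ^ 2 - y ^ 2 := by nlinarith [hy.1, hy.2]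
  have hm' : HasDerivAt (fun x : ℝ => R ^ 2 - x ^ 2) (-(2 * y)) y := by
    simpa using (hasDerivAt_pow 2 y).const_sub (R ^ 2)
  have hZ' : HasDerivAt (fun x : ℝ => c - δ * Real.log (R ^ 2 - x ^ 2))
      (-(δ * (-(2 * y) / (R ^ 2 - y ^ 2)))) y :=
    ((hm'.log hm.ne').const_mul δ).const_sub c
  have h1 := hZ'.rpow_const (p := r) (Or.inl hZ.ne')
  have h2 := hZ'.rpow_const (p := r - 1) (Or.inl hZ.ne')
  constructor
  · refine ((hm'.const_mul κ).mul h1).congr_deriv ?_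
    field_simp
    ring
  · refine (((hasDerivAt_id y).const_mul (-2 * κ)).mul (h1.sub (h2.const_mul (δ * r)))).congr_deriv ?_
    simp only [id, Pi.sub_apply]
    field_simp
    ring

/-- First and second derivatives of `P (A (s + ε) ^ (-q) + c) ^ r`. -/
theorem hasDerivAt_timeBarrier {P A ε q c r t : ℝ} (ht : 0 < t + ε)
    (hZ : 0 < A * (t + ε) ^ (-q) + c) :
    HasDerivAt (fun s => P * (A * (s + ε) ^ (-q) + c) ^ r)
      (P * (A * (-q * (t + ε) ^ (-q - 1)) * r * (A * (t + ε) ^ (-q) + c) ^ (r - 1))) t ∧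
    HasDerivAt (fun s => P * (A * (-q * (s + ε) ^ (-q - 1)) * r
        * (A * (s + ε) ^ (-q) + c) ^ (r - 1)))
      (P * (r * (A * (t + ε) ^ (-q) + c) ^ (r - 1)
          * (A * (q * (q + 1) * (t + ε) ^ (-q - 1 - 1)))
        - r * (1 - r) * (A * (t + ε) ^ (-q) + c) ^ (r - 1 - 1)
          * (A * (-q * (t + ε) ^ (-q - 1))) ^ 2)) t := by
  have h0 : HasDerivAt (fun s : ℝ => s + ε) 1 t := (hasDerivAt_id t).add_const ε
  have hU : HasDerivAt (fun s : ℝ => A * (s + ε) ^ (-q) + c)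
      (A * (-q * (t + ε) ^ (-q - 1))) t := by
    refine (((h0.rpow_const (p := -q) (Or.inl ht.ne')).const_mul A).add_const c).congr_deriv ?_
    ring
  have hU' := ((h0.rpow_const (p := -q - 1) (Or.inl ht.ne')).const_mul (-q)).const_mul A
  have h1 := hU.rpow_const (p := r) (Or.inl hZ.ne')
  have h2 := hU.rpow_const (p := r - 1) (Or.inl hZ.ne')
  constructor
  · exact h1.const_mul P
  · refine (((hU'.mul_const r).mul h2).const_mul P).congr_deriv ?_
    ring

/-- The comparison function `B ^ (θ + 1) τ ^ (-α (θ + 1))` is a power of `τ ^ α / B`. -/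
theorem comparison_eq_rpow {θ α B τ : ℝ} (hB : 0 < B) (hτ : 0 < τ) :
    B ^ (θ + 1) * τ ^ (-(α * (θ + 1))) = (B⁻¹ * τ ^ α) ^ (-(θ + 1)) := by
  rw [Real.mul_rpow (by positivity) (by positivity), ← Real.rpow_mul hτ.le,
    Real.inv_rpow hB.le, Real.rpow_neg hB.le, inv_inv]
  ring_nf

/-- The comparison function is a strict supersolution, so the touching inequality of
`barrier_touching_ineq` cannot hold above it. -/
theorem strict_supersolution {θ α k r q B τ U Z G δ : ℝ} (hθ : 0 < θ) (hα : α = 2 / (2 + θ))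
    (hr : r = θ / (θ + 1)) (hq : q = α * (θ + 1)) (hk : 0 < k) (hB : 1 ≤ B)
    (hBk : 2 * (r * (q * (q + 1))) ≤ θ * k * B) (hτ : 0 < τ) (hG : 0 < G)
    (hU : U = B ^ (θ + 1) * τ ^ (-q)) (hUZ : U ≤ Z) (hZ : Z = G ^ (-(θ + 1)))
    (hδ : 0 < δ) (hδU : 2 * δ < U) :
    r * G ^ 2 * (B ^ (θ + 1) * (q * (q + 1) * τ ^ (-q - 1 - 1)))
      < θ * k * (Z - δ * r) * G ^ (-θ) := by
  have hB0 : 0 < B := by linarith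
  have hα0 : 0 < α := by rw [hα]; positivity
  have hr0 : 0 < r := by rw [hr]; positivity
  have hr1 : r < 1 := by rw [hr, div_lt_one (by positivity)]; linarith
  have hq0 : 0 < q := by rw [hq]; positivity
  have hGle : G ≤ B⁻¹ * τ ^ α := by
    have h : (B⁻¹ * τ ^ α) ^ (-(θ + 1)) ≤ G ^ (-(θ + 1)) := by
      rw [← comparison_eq_rpow hB0 hτ, ← hq, ← hU, ← hZ]; exact hUZ
    exact (Real.rpow_le_rpow_iff_of_neg (by positivity) hG (by linarith)).1 h
  have hpow : G ^ (2 + θ) ≤ B⁻¹ * τ ^ 2 := by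
    calc G ^ (2 + θ) ≤ (B⁻¹ * τ ^ α) ^ (2 + θ) :=
          Real.rpow_le_rpow hG.le hGle (by linarith)
      _ = (B⁻¹) ^ (2 + θ) * τ ^ 2 := by
          rw [Real.mul_rpow (by positivity) (by positivity), ← Real.rpow_mul hτ.le, hα,
            div_mul_cancel₀ _ (by positivity)]
          norm_num
      _ ≤ B⁻¹ * τ ^ 2 := by
          gcongr
          calc (B⁻¹) ^ (2 + θ) ≤ (B⁻¹) ^ (1 : ℝ) :=
                Real.rpow_le_rpow_of_exponent_ge (by positivity)
                  (inv_le_one_of_one_le₀ hB) (by linarith)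
            _ = B⁻¹ := Real.rpow_one _
  have ha : 0 < G ^ (-θ) := Real.rpow_pos_of_pos hG _
  have hG2 : G ^ 2 ≤ B⁻¹ * τ ^ 2 * G ^ (-θ) := by
    calc G ^ 2 = G ^ (2 + θ) * G ^ (-θ) := by
          rw [← Real.rpow_add hG]; norm_num
      _ ≤ _ := by gcongr
  have hU0 : 0 < U := by rw [hU]; positivity
  have hW : B ^ (θ + 1) * (q * (q + 1) * τ ^ (-q - 1 - 1)) = q * (q + 1) * U / τ ^ 2 := by
    rw [hU, Real.rpow_sub_one hτ.ne', Real.rpow_sub_one hτ.ne']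
    field_simp
  have hZδ : U / 2 < Z - δ * r := by nlinarith
  calc r * G ^ 2 * (B ^ (θ + 1) * (q * (q + 1) * τ ^ (-q - 1 - 1)))
      = r * G ^ 2 * (q * (q + 1) * U / τ ^ 2) := by rw [hW]
    _ ≤ r * (B⁻¹ * τ ^ 2 * G ^ (-θ)) * (q * (q + 1) * U / τ ^ 2) := by gcongr
    _ = (2 * (r * (q * (q + 1)))) * (B⁻¹ * (U / 2) * G ^ (-θ)) := by field_simp
    _ ≤ (θ * k * B) * (B⁻¹ * (U / 2) * G ^ (-θ)) := by gcongr
    _ = θ * k * (U / 2) * G ^ (-θ) := by field_simp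
    _ < θ * k * (Z - δ * r) * G ^ (-θ) := by gcongr

/-- sharp lower bound g(t,y) ≥ C₂⁻¹(t+ε)^α for the space derivative of
the rescaled Lagrangian flow, with C₂ depending only on θ, T, C₁ (not on ε or g). -/
theorem stmt_8 (θ : ℝ) (hθ : 0 < θ)
    (α : ℝ) (hα : α = 2 / (2 + θ))
    (R : ℝ) (hR : 0 < R)
    (φ : ℝ → ℝ)
    (hφ : ∀ r, φ r = (max ((1/2) * α * (1 - α) * (R^2 - r^2)) 0) ^ (1/θ))
    (hφint : (∫ r : ℝ, φ r) = 1)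
    (T C₁ : ℝ) (hT : 0 < T) (hC₁ : 1 ≤ C₁) :
    ∃ C₂ > 0, ∀ ε ∈ Ioo (0:ℝ) 1, ∀ g v : ℝ → ℝ → ℝ,
      ContinuousOn (fun p : ℝ × ℝ => g p.1 p.2) (Icc 0 T ×ˢ Icc (-R) R) →
      (∀ t ∈ Icc 0 T, ∀ y ∈ Icc (-R) R, 0 < g t y) →
      ContDiffOn ℝ 2 (fun p : ℝ × ℝ => g p.1 p.2) (Ioo 0 T ×ˢ Ioo (-R) R) →
      (∀ t ∈ Icc 0 T, ∀ y ∈ Icc (-R) R, g t y ≤ C₁ * (t + ε) ^ α) →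
      (∀ y ∈ Ioo (-R) R, g 0 y = ε ^ α) →
      (∀ y ∈ Ioo (-R) R, C₁⁻¹ ≤ g T y) →
      (∀ t x, v t x = (φ x) ^ θ / (g t x) ^ θ) →
      (∀ t ∈ Ioo 0 T, ∀ y ∈ Ioo (-R) R,
        -(deriv (deriv (fun s => v s y)) t)
            - (θ * v t y / (g t y)^2) * deriv (deriv (fun z => v t z)) y
          ≤ -(deriv (fun z => v t z) y / (g t y)^2) *
              ((-(α*(1-α)*y)) / (g t y) ^ θ - deriv (fun z => v t z) y)) →
      ∀ t ∈ Icc 0 T, ∀ y ∈ Ioo (-R) R, C₂⁻¹ * (t + ε) ^ α ≤ g t y := by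
  have hα0 : 0 < α := by rw [hα]; positivity
  have hα1 : α < 1 := by rw [hα, div_lt_one (by positivity)]; linarith
  have h1α : 0 < 1 - α := by linarith
  obtain ⟨κ, hκ⟩ : ∃ κ, κ = (1/2) * α * (1 - α) := ⟨_, rfl⟩
  have hκ0 : 0 < κ := by rw [hκ]; positivity
  obtain ⟨q, hq⟩ : ∃ q, q = α * (θ + 1) := ⟨_, rfl⟩
  have hq0 : 0 < q := by rw [hq]; positivity
  obtain ⟨r, hr⟩ : ∃ r, r = θ / (θ + 1) := ⟨_, rfl⟩
  have hr0 : 0 < r := by rw [hr]; positivity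
  have hr1 : r < 1 := by rw [hr, div_lt_one (by positivity)]; linarith
  obtain ⟨B, hB⟩ : ∃ B, B = 1 + C₁ * (T + 1) ^ α + 2 * (r * (q * (q + 1))) / (θ * (2 * κ)) :=
    ⟨_, rfl⟩
  have hBa : 0 ≤ C₁ * (T + 1) ^ α := by positivity
  have hBb : 0 ≤ 2 * (r * (q * (q + 1))) / (θ * (2 * κ)) := by positivity
  have hB1 : 1 ≤ B := by rw [hB]; linarith
  have hB0 : 0 < B := by linarith
  have hBk : 2 * (r * (q * (q + 1))) ≤ θ * (2 * κ) * B := by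
    rw [← div_le_iff₀' (by positivity), hB]; linarith
  refine ⟨B, hB0, ?_⟩
  intro ε hε g v hgc hgpos hgC2 _ hg0 hgT hv hpde t₀ ht₀ y₀ hy₀
  by_contra! hlt
  have hτ : ∀ t ∈ Icc 0 T, 0 < t + ε := fun t ht => by linarith [ht.1, hε.1]
  set U : ℝ → ℝ := fun t => B ^ (θ + 1) * (t + ε) ^ (-q) with hU
  have hUpos : ∀ t ∈ Icc 0 T, 0 < U t := fun t ht => by have := hτ t ht; positivity
  have hUeq : ∀ t ∈ Icc 0 T, U t = (B⁻¹ * (t + ε) ^ α) ^ (-(θ + 1)) := fun t ht => by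
    simp only [hU, hq]; exact comparison_eq_rpow hB0 (hτ t ht)
  set z : ℝ → ℝ → ℝ := fun t y => (g t y) ^ (-(θ + 1)) with hz
  have hzU : ∀ t ∈ Icc 0 T, ∀ y ∈ Icc (-R) R, B⁻¹ * (t + ε) ^ α ≤ g t y → z t y ≤ U t := by
    intro t ht y hy h
    have := hτ t ht
    rw [hUeq t ht]
    exact Real.rpow_le_rpow_of_nonpos (by positivity) h (by linarith)
  have hz₀ : U t₀ < z t₀ y₀ := by
    rw [hUeq t₀ ht₀]
    exact Real.rpow_lt_rpow_of_neg (hgpos _ ht₀ _ (Ioo_subset_Icc_self hy₀)) hlt (by linarith)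
  have hUT : ∀ t ∈ Icc 0 T, U T ≤ U t := fun t ht => by
    have := hτ t ht
    simp only [hU]
    gcongr ?_ * ?_
    exact Real.rpow_le_rpow_of_nonpos this (by linarith [ht.2]) (by linarith)
  have hzc : ContinuousOn (fun p : ℝ × ℝ => z p.1 p.2) (Icc 0 T ×ˢ Icc (-R) R) :=
    hgc.rpow_const fun p hp => Or.inl (hgpos _ hp.1 _ hp.2).ne'
  obtain ⟨M, hM⟩ := (isCompact_Icc.prod isCompact_Icc).exists_bound_of_continuousOn hzc
  have hzM : ∀ t ∈ Icc 0 T, ∀ y ∈ Icc (-R) R, z t y ≤ M := fun t ht y hy =>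
    (le_abs_self _).trans (hM (t, y) ⟨ht, hy⟩)
  -- the logarithmic barrier
  set b : ℝ → ℝ := fun y => Real.log (R ^ 2) - Real.log (R ^ 2 - y ^ 2) with hb
  have hm : ∀ y ∈ Ioo (-R) R, 0 < R ^ 2 - y ^ 2 := fun y hy => by nlinarith [hy.1, hy.2]
  have hb0 : ∀ y ∈ Ioo (-R) R, 0 ≤ b y := fun y hy => by
    have := Real.log_le_log (hm y hy) (show R ^ 2 - y ^ 2 ≤ R ^ 2 by nlinarith)
    simp only [hb]; linarith
  have hTI : T ∈ Icc 0 T := ⟨hT.le, le_rfl⟩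
  have h0I : (0:ℝ) ∈ Icc 0 T := ⟨le_rfl, hT.le⟩
  obtain ⟨δ, hδ0, hδb, hδU⟩ : ∃ δ > 0, δ * b y₀ < z t₀ y₀ - U t₀ ∧ 2 * δ < U T := by
    have h1 : ∀ᶠ δ in 𝓝[>] (0:ℝ), δ * b y₀ < z t₀ y₀ - U t₀ := by
      have : Tendsto (fun δ : ℝ => δ * b y₀) (𝓝 0) (𝓝 (0 * b y₀)) :=
        tendsto_id.mul_const _
      rw [zero_mul] at this
      exact (this.mono_left nhdsWithin_le_nhds).eventually_lt_const (by linarith)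
    have h2 : ∀ᶠ δ in 𝓝[>] (0:ℝ), 2 * δ < U T := by
      have : Tendsto (fun δ : ℝ => 2 * δ) (𝓝 0) (𝓝 (2 * 0)) := tendsto_id.const_mul _
      rw [mul_zero] at this
      exact (this.mono_left nhdsWithin_le_nhds).eventually_lt_const (hUpos T hTI)
    obtain ⟨δ, ⟨h1, h2⟩, h3⟩ := ((h1.and h2).and self_mem_nhdsWithin).exists
    exact ⟨δ, h3, h1, h2⟩
  obtain ⟨ρ, hρR, hρy, hρM⟩ : ∃ ρ, ρ < R ∧ |y₀| < ρ ∧ M ≤ δ * b ρ := by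
    have hy₀' : |y₀| < R := abs_lt.2 hy₀
    have h1 : Tendsto (fun ρ : ℝ => R ^ 2 - ρ ^ 2) (𝓝[<] R) (𝓝[>] 0) := by
      refine tendsto_nhdsWithin_iff.2 ⟨?_, ?_⟩
      · have : Tendsto (fun ρ : ℝ => R ^ 2 - ρ ^ 2) (𝓝 R) (𝓝 (R ^ 2 - R ^ 2)) :=
          (show Continuous fun ρ : ℝ => R ^ 2 - ρ ^ 2 by fun_prop).tendsto R
        rw [sub_self] at this
        exact this.mono_left nhdsWithin_le_nhds
      · filter_upwards [Ioo_mem_nhdsLT hy₀'] with ρ hρ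
        exact hm ρ ⟨by linarith [abs_nonneg y₀, hρ.1], hρ.2⟩
    have h2 : ∀ᶠ ρ in 𝓝[<] R, Real.log (R ^ 2 - ρ ^ 2) ≤ Real.log (R ^ 2) - M / δ :=
      (Real.tendsto_log_nhdsGT_zero.comp h1).eventually_le_atBot _
    obtain ⟨ρ, h3, h4⟩ := (h2.and (Ioo_mem_nhdsLT hy₀')).exists
    refine ⟨ρ, h4.2, h4.1, ?_⟩
    rw [← div_le_iff₀' hδ0]
    simp only [hb]; linarith
  have hρ0 : 0 < ρ := (abs_nonneg _).trans_lt hρy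
  have hρsub : Icc (-ρ) ρ ⊆ Ioo (-R) R := Icc_subset_Ioo (by linarith) hρR
  have hρsub' : Icc (-ρ) ρ ⊆ Icc (-R) R := hρsub.trans Ioo_subset_Icc_self
  have hFc : ContinuousOn (fun p : ℝ × ℝ => z p.1 p.2 - U p.1 - δ * b p.2)
      (Icc 0 T ×ˢ Icc (-ρ) ρ) := by
    refine ((hzc.mono (prod_mono le_rfl hρsub')).sub ?_).sub ?_
    · refine continuousOn_const.mul (ContinuousOn.rpow_const (by fun_prop) ?_)
      exact fun p hp => Or.inl (hτ _ hp.1).ne'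
    · refine continuousOn_const.mul (continuousOn_const.sub (ContinuousOn.log (by fun_prop) ?_))
      exact fun p hp => (hm _ (hρsub hp.2)).ne'
  obtain ⟨t₁, ht₁, y₁, hy₁, hFpos, hFmax⟩ :=
    exists_interior_max_of_boundary_nonpos (F := fun t y => z t y - U t - δ * b y) hFc ht₀
      (abs_le.1 hρy.le) (by linarith)
      (fun y hy => by
        have h1 := hzU 0 h0I y (hρsub' hy) (by
          rw [hg0 y (hρsub hy), zero_add]
          exact mul_le_of_le_one_left (by have := hε.1; positivity) (inv_le_one_of_one_le₀ hB1))
        have h2 := mul_nonneg hδ0.le (hb0 y (hρsub hy))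
        linarith)
      (fun y hy => by
        have h1 := hzU T hTI y (hρsub' hy) (by
          refine le_trans ?_ (hgT y (hρsub hy))
          have h3 : (T + ε) ^ α ≤ (T + 1) ^ α :=
            Real.rpow_le_rpow (hτ T hTI).le (by linarith [hε.2]) hα0.le
          rw [inv_mul_le_iff₀ hB0, ← div_eq_mul_inv, le_div_iff₀ (by linarith)]
          nlinarith)
        have h2 := mul_nonneg hδ0.le (hb0 y (hρsub hy))
        linarith)
      (fun t ht => by
        have h1 := hzM t ht (-ρ) (hρsub' ⟨le_rfl, by linarith⟩)
        have h2 := hUpos t ht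
        have h3 : b (-ρ) = b ρ := by simp only [hb, neg_sq]
        rw [h3]
        linarith)
      (fun t ht => by
        have h1 := hzM t ht ρ (hρsub' ⟨by linarith, le_rfl⟩)
        have h2 := hUpos t ht
        linarith)
  obtain ⟨N, hN⟩ : ∃ N, N = z t₁ y₁ - U t₁ - δ * b y₁ := ⟨_, rfl⟩
  rw [← hN] at hFpos hFmax
  have ht₁' := Ioo_subset_Icc_self ht₁
  have hy₁' : y₁ ∈ Ioo (-R) R := hρsub (Ioo_subset_Icc_self hy₁)
  have hτ₁ := hτ t₁ ht₁'
  have hg₁ := hgpos t₁ ht₁' y₁ (Ioo_subset_Icc_self hy₁')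
  have hb₁ := mul_nonneg hδ0.le (hb0 y₁ hy₁')
  have hφθ : ∀ y ∈ Ioo (-R) R, φ y ^ θ = κ * (R ^ 2 - y ^ 2) := fun y hy => by
    have h1 : 0 < κ * (R ^ 2 - y ^ 2) := mul_pos hκ0 (hm y hy)
    rw [hφ, ← hκ, max_eq_left h1.le, ← Real.rpow_mul h1.le, one_div_mul_cancel hθ.ne',
      Real.rpow_one]
  have hvle : ∀ t ∈ Icc 0 T, ∀ y ∈ Ioo (-R) R, ∀ Z, z t y ≤ Z →
      v t y ≤ κ * (R ^ 2 - y ^ 2) * Z ^ r := by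
    intro t ht y hy Z hZ
    have hg := hgpos t ht y (Ioo_subset_Icc_self hy)
    have h1 : g t y ^ (-θ) = z t y ^ r := by
      rw [← Real.rpow_mul hg.le, hr]
      congr 1
      field_simp
    rw [hv, hφθ y hy, div_eq_mul_inv, ← Real.rpow_neg hg.le, h1]
    have h2 := mul_pos hκ0 (hm y hy)
    gcongr
  have hveq : ∀ Z, Z = z t₁ y₁ → Z ^ r = g t₁ y₁ ^ (-θ) := by
    rintro Z rfl
    rw [← Real.rpow_mul hg₁.le, hr]
    congr 1
    field_simp
  have hv₁ : v t₁ y₁ = κ * (R ^ 2 - y₁ ^ 2) * g t₁ y₁ ^ (-θ) := by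
    rw [hv, hφθ y₁ hy₁', div_eq_mul_inv, ← Real.rpow_neg hg₁.le]
  have hgat : ContDiffAt ℝ 2 (fun p : ℝ × ℝ => g p.1 p.2) (t₁, y₁) :=
    hgC2.contDiffAt ((isOpen_Ioo.prod isOpen_Ioo).mem_nhds ⟨ht₁, hy₁'⟩)
  have hgt : ContDiffAt ℝ 2 (fun s => g s y₁) t₁ :=
    ContDiffAt.comp t₁ (f := fun s : ℝ => (s, y₁)) hgat (by fun_prop)
  have hgy : ContDiffAt ℝ 2 (fun x => g t₁ x) y₁ :=
    ContDiffAt.comp y₁ (f := fun x : ℝ => (t₁, x)) hgat (by fun_prop)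
  have hvt : ContDiffAt ℝ 2 (fun s => v s y₁) t₁ := by
    simp only [hv]
    exact contDiffAt_const.div (hgt.rpow_const_of_ne hg₁.ne')
      (Real.rpow_pos_of_pos hg₁ _).ne'
  have hvy : ContDiffAt ℝ 2 (fun x => v t₁ x) y₁ := by
    have h1 : ContDiffAt ℝ 2 (fun x => κ * (R ^ 2 - x ^ 2) / g t₁ x ^ θ) y₁ :=
      ContDiffAt.div (by fun_prop) (hgy.rpow_const_of_ne hg₁.ne')
        (Real.rpow_pos_of_pos hg₁ _).ne'
    refine h1.congr_of_eventuallyEq ?_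
    filter_upwards [isOpen_Ioo.mem_nhds hy₁'] with x hx
    rw [hv, hφθ x hx]
  -- comparison in time
  obtain ⟨c, hc⟩ : ∃ c, c = δ * b y₁ + N := ⟨_, rfl⟩
  have hcZ : U t₁ + c = z t₁ y₁ := by rw [hc, hN]; ring
  have htI : ∀ᶠ s in 𝓝 t₁, s ∈ Ioo 0 T := isOpen_Ioo.mem_nhds ht₁
  have hUc : ∀ s ∈ Icc 0 T, 0 < U s + c := fun s hs => by linarith [hUpos s hs]
  have htime := (deriv_eq_and_deriv2_le_of_eventually_le hvt
    (htI.mono fun s hs => (hasDerivAt_timeBarrier (P := κ * (R ^ 2 - y₁ ^ 2)) (r := r)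
      (hτ s (Ioo_subset_Icc_self hs)) (hUc s (Ioo_subset_Icc_self hs))).1)
    (hasDerivAt_timeBarrier hτ₁ (hUc t₁ ht₁')).2
    (htI.mono fun s hs => hvle s (Ioo_subset_Icc_self hs) y₁ hy₁' _ (by
      have := hFmax s (Ioo_subset_Icc_self hs) y₁ (Ioo_subset_Icc_self hy₁)
      simp only [hU] at this
      linarith))
    (by rw [hveq _ hcZ]; exact hv₁)).2
  -- comparison in space
  obtain ⟨c', hc'⟩ : ∃ c', c' = U t₁ + δ * Real.log (R ^ 2) + N := ⟨_, rfl⟩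
  have hcb : ∀ x, c' - δ * Real.log (R ^ 2 - x ^ 2) = U t₁ + δ * b x + N := fun x => by
    simp only [hc', hb]; ring
  have hcZ' : c' - δ * Real.log (R ^ 2 - y₁ ^ 2) = z t₁ y₁ := by rw [hcb, hN]; ring
  have hyI : ∀ᶠ x in 𝓝 y₁, x ∈ Ioo (-ρ) ρ := isOpen_Ioo.mem_nhds hy₁
  have hcpos : ∀ x ∈ Ioo (-R) R, 0 < c' - δ * Real.log (R ^ 2 - x ^ 2) := fun x hx => by
    have := mul_nonneg hδ0.le (hb0 x hx)
    rw [hcb]; linarith [hUpos t₁ ht₁']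
  have hρI : ∀ x ∈ Ioo (-ρ) ρ, x ∈ Ioo (-R) R := fun x hx => hρsub (Ioo_subset_Icc_self hx)
  obtain ⟨hspace1, hspace2⟩ := deriv_eq_and_deriv2_le_of_eventually_le hvy
    (hyI.mono fun x hx => (hasDerivAt_logBarrier (r := r) hκ0 (hρI x hx)
      (hcpos x (hρI x hx))).1)
    (hasDerivAt_logBarrier hκ0 hy₁' (hcpos y₁ hy₁')).2
    (hyI.mono fun x hx => hvle t₁ ht₁' x (hρI x hx) _ (by
      have := hFmax t₁ ht₁' x (Ioo_subset_Icc_self hx)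
      rw [hcb]
      linarith))
    (by rw [hveq _ hcZ']; exact hv₁)
  have hZ0 : 0 < z t₁ y₁ := Real.rpow_pos_of_pos hg₁ _
  have ha0 : 0 < g t₁ y₁ ^ (-θ) := Real.rpow_pos_of_pos hg₁ _
  simp only [hU] at hcZ
  rw [hcZ, Real.rpow_sub_one hZ0.ne' (r - 1), Real.rpow_sub_one hZ0.ne' r, hveq _ rfl] at htime
  rw [hcZ', Real.rpow_sub_one hZ0.ne' r, hveq _ rfl] at hspace1
  rw [hcZ', Real.rpow_sub_one hZ0.ne' (r - 1), Real.rpow_sub_one hZ0.ne' r, hveq _ rfl]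
    at hspace2
  have hineq := hpde t₁ ht₁ y₁ hy₁'
  rw [hv₁] at hineq
  have hd : -(α * (1 - α) * y₁) / g t₁ y₁ ^ θ = (-2 * κ * y₁) * g t₁ y₁ ^ (-θ) := by
    rw [Real.rpow_neg hg₁.le, hκ]; ring
  rw [hd] at hineq
  have hP := mul_pos hκ0 (hm y₁ hy₁')
  have hle := barrier_touching_ineq (k := 2 * κ) hθ hr hδ0 hZ0 ha0 hP hg₁
    (htime.trans (by
      gcongr
      have : 0 ≤ r * (1 - r) * (g t₁ y₁ ^ (-θ) / z t₁ y₁ / z t₁ y₁)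
          * (B ^ (θ + 1) * (-q * (t₁ + ε) ^ (-q - 1))) ^ 2 := by
        have : 0 < 1 - r := by linarith
        positivity
      exact sub_le_self _ this))
    hspace1 (by rwa [sq (z t₁ y₁), ← div_div (g t₁ y₁ ^ (-θ))]) hineq
  have hlt' := strict_supersolution (U := U t₁) (Z := z t₁ y₁) hθ hα hr hq
    (by positivity : 0 < 2 * κ) hB1 hBk hτ₁ hg₁ rfl (by linarith) rfl hδ0
    (hδU.trans_le (hUT t₁ ht₁'))
  linarith
end

section
/- Let θ>0, α := 2/(2+θ), ε ∈ (0,1), T>0, C₁>0, and t₀ ∈ (0,(T−ε)/2]. Suppose: (i) u is C¹ on [t₀, 2t₀+ε]×ℝ, m : [t₀,2t₀+ε]×ℝ → [0,∞) is continuous, and −∂_t u(t,x) + (1/2)(∂_x u(t,x))² = m(t,x)^θ at every point; (ii) m(t,x) ≤ C₁(t+ε)^{−α} for all (t,x); (iii) {x : m(t,x)>0} ⊆ [−C₁(t+ε)^{α}, C₁(t+ε)^{α}] for every t ∈ [t₀,2t₀+ε]; (iv) there exist c<d and a C¹ map γ : [t₀,2t₀+ε]×(c,d) → ℝ such that ∂_t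 γ(t,ξ) = −∂_x u(t, γ(t,ξ)) and {x : m(t,x)>0} = γ(t,(c,d)) for every t ∈ [t₀,2t₀+ε]. Then there exists C>0, depending only on θ and C₁, such that sup_S u − inf_S u ≤ C (t₀+ε)^{2α−1}, where S := {(t,x) : t ∈ [t₀, 2t₀+ε], m(t,x)>0}. -/
open MeasureTheory Set

/-- Chain rule for a function of two real variables along a curve, in terms of its
partial derivatives. -/
lemma hasDerivAt_along_curve {u : ℝ → ℝ → ℝ} {β : ℝ → ℝ} {b t : ℝ}
    (hu : DifferentiableAt ℝ (fun p : ℝ × ℝ => u p.1 p.2) (t, β t)) (hβ : HasDerivAt β b t) :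
    HasDerivAt (fun s => u s (β s))
      (deriv (fun s => u s (β t)) t + deriv (fun y => u t y) (β t) * b) t := by
  obtain ⟨L, hL⟩ := hu
  have h1 : HasDerivAt (fun s => u s (β t)) (L (1, 0)) t :=
    HasFDerivAt.comp_hasDerivAt (f := fun s => (s, β t)) t hL
      ((hasDerivAt_id t).prodMk (hasDerivAt_const t (β t)))
  have h2 : HasDerivAt (fun y => u t y) (L (0, 1)) (β t) :=
    hL.comp_hasDerivAt (β t) ((hasDerivAt_const (β t) t).prodMk (hasDerivAt_id (β t)))
  have h3 : HasDerivAt (fun s => u s (β s)) (L (1, b)) t :=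
    HasFDerivAt.comp_hasDerivAt (f := fun s => (s, β s)) t hL ((hasDerivAt_id t).prodMk hβ)
  have h4 : L (1, b) = L (1, 0) + L (0, 1) * b := by
    have : ((1, b) : ℝ × ℝ) = (1, 0) + b • (0, 1) := by simp
    rw [this, map_add, map_smul, smul_eq_mul, mul_comm]
  rw [h1.deriv, h2.deriv, ← h4]
  exact h3

lemma differentiableAt_of_mem_strip {u : ℝ → ℝ → ℝ} {t₁ t₂ t : ℝ} (x : ℝ)
    (hu : ContDiffOn ℝ 1 (fun p : ℝ × ℝ => u p.1 p.2) (Icc t₁ t₂ ×ˢ univ))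
    (ht : t ∈ Ioo t₁ t₂) : DifferentiableAt ℝ (fun p : ℝ × ℝ => u p.1 p.2) (t, x) :=
  (hu.contDiffAt (prod_mem_nhds (Icc_mem_nhds ht.1 ht.2) Filter.univ_mem)).differentiableAt
    one_ne_zero

lemma continuousOn_along_curve {u : ℝ → ℝ → ℝ} {β : ℝ → ℝ} {t₁ t₂ : ℝ}
    (hu : ContDiffOn ℝ 1 (fun p : ℝ × ℝ => u p.1 p.2) (Icc t₁ t₂ ×ˢ univ))
    (hβ : ContinuousOn β (Icc t₁ t₂)) : ContinuousOn (fun s => u s (β s)) (Icc t₁ t₂) :=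
  hu.continuousOn.comp (continuousOn_id.prodMk hβ) fun _ hs => ⟨hs, mem_univ _⟩

/-- A solution of a Hamilton–Jacobi equation with nonnegative source is nonincreasing along
the optimal trajectories. -/
lemma antitoneOn_along_optimal_trajectory {u f : ℝ → ℝ → ℝ} {β : ℝ → ℝ} {t₁ t₂ : ℝ}
    (hu : ContDiffOn ℝ 1 (fun p : ℝ × ℝ => u p.1 p.2) (Icc t₁ t₂ ×ˢ univ))
    (hHJ : ∀ t ∈ Icc t₁ t₂, ∀ x : ℝ,
      -(deriv (fun s => u s x) t) + (1/2) * (deriv (fun y => u t y) x)^2 = f t x)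
    (hf : ∀ t ∈ Icc t₁ t₂, ∀ x, 0 ≤ f t x)
    (hβ : ∀ t ∈ Icc t₁ t₂, HasDerivAt β (-(deriv (fun y => u t y) (β t))) t) :
    AntitoneOn (fun s => u s (β s)) (Icc t₁ t₂) := by
  have hd : ∀ t ∈ Ioo t₁ t₂, _ := fun t ht =>
    hasDerivAt_along_curve (differentiableAt_of_mem_strip (β t) hu ht)
      (hβ t (Ioo_subset_Icc_self ht))
  refine antitoneOn_of_deriv_nonpos (convex_Icc _ _)
    (continuousOn_along_curve hu fun t ht => (hβ t ht).continuousAt.continuousWithinAt) ?_ ?_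
  · rw [interior_Icc]
    exact fun t ht => (hd t ht).differentiableAt.differentiableWithinAt
  · rw [interior_Icc]
    intro t ht
    rw [(hd t ht).deriv]
    have h1 := hHJ t (Ioo_subset_Icc_self ht) (β t)
    have h2 := hf t (Ioo_subset_Icc_self ht) (β t)
    nlinarith [sq_nonneg (deriv (fun y => u t y) (β t))]

/-- Hopf–Lax type bound for a solution of a Hamilton–Jacobi equation with bounded source,
obtained by testing with the straight line between two points. -/
lemma sub_le_straight_line_cost {u f : ℝ → ℝ → ℝ} {t₁ t₂ K : ℝ} (h12 : t₁ < t₂)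
    (hu : ContDiffOn ℝ 1 (fun p : ℝ × ℝ => u p.1 p.2) (Icc t₁ t₂ ×ˢ univ))
    (hHJ : ∀ t ∈ Icc t₁ t₂, ∀ x : ℝ,
      -(deriv (fun s => u s x) t) + (1/2) * (deriv (fun y => u t y) x)^2 = f t x)
    (hf : ∀ t ∈ Icc t₁ t₂, ∀ x, f t x ≤ K) (x z : ℝ) :
    u t₁ z - u t₂ x ≤ (x - z)^2 / (2 * (t₂ - t₁)) + K * (t₂ - t₁) := by
  have hne : t₂ - t₁ ≠ 0 := (sub_pos.2 h12).ne'
  set b : ℝ := (x - z) / (t₂ - t₁) with hb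
  let β : ℝ → ℝ := fun s => z + (s - t₁) * b
  have hβ : ∀ t, HasDerivAt β b t := fun t => by
    simpa [β] using (((hasDerivAt_id t).sub_const t₁).mul_const b).const_add z
  have hd : ∀ t ∈ Ioo t₁ t₂, _ := fun t ht =>
    (hasDerivAt_along_curve (differentiableAt_of_mem_strip (β t) hu ht) (hβ t)).add
      ((hasDerivAt_id t).const_mul (b^2 / 2 + K))
  have hmono : MonotoneOn (fun s => u s (β s) + (b^2 / 2 + K) * s) (Icc t₁ t₂) := by
    refine monotoneOn_of_deriv_nonneg (convex_Icc _ _)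
      ((continuousOn_along_curve hu fun t _ => (hβ t).continuousAt.continuousWithinAt).add
        (by fun_prop)) ?_ ?_
    · rw [interior_Icc]
      exact fun t ht => (hd t ht).differentiableAt.differentiableWithinAt
    · rw [interior_Icc]
      intro t ht
      have h0 : deriv (fun s => u s (β s) + (b^2 / 2 + K) * s) t = _ := (hd t ht).deriv
      rw [h0]
      have h1 := hHJ t (Ioo_subset_Icc_self ht) (β t)
      have h2 := hf t (Ioo_subset_Icc_self ht) (β t)
      nlinarith [sq_nonneg (deriv (fun y => u t y) (β t) + b)]
  have h := hmono (left_mem_Icc.2 h12.le) (right_mem_Icc.2 h12.le) h12.le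
  have e1 : β t₁ = z := by simp [β]
  have e2 : β t₂ = x := by simp only [β, hb]; field_simp; ring
  have e3 : (x - z)^2 / (2 * (t₂ - t₁)) = b^2 / 2 * (t₂ - t₁) := by
    rw [hb]; field_simp
  simp only [e1, e2] at h
  rw [e3]
  linarith

/-- oscillation estimate osc_S u ≤ C(t₀+ε)^{2α−1} for the value function
on the space-time positivity set S of m, with C depending only on θ and C₁. -/
theorem stmt_9 (θ : ℝ) (hθ : 0 < θ)
    (α : ℝ) (hα : α = 2 / (2 + θ))
    (C₁ : ℝ) (hC₁ : 0 < C₁) :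
    ∃ C > 0, ∀ T > (0:ℝ), ∀ ε ∈ Ioo (0:ℝ) 1, ∀ t₀ ∈ Ioc (0:ℝ) ((T - ε)/2),
      ∀ u m : ℝ → ℝ → ℝ, ∀ c d : ℝ, ∀ γ : ℝ → ℝ → ℝ,
      ContDiffOn ℝ 1 (fun p : ℝ × ℝ => u p.1 p.2) (Icc t₀ (2*t₀+ε) ×ˢ univ) →
      ContinuousOn (fun p : ℝ × ℝ => m p.1 p.2) (Icc t₀ (2*t₀+ε) ×ˢ univ) →
      (∀ t ∈ Icc t₀ (2*t₀+ε), ∀ x : ℝ, 0 ≤ m t x) →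
      (∀ t ∈ Icc t₀ (2*t₀+ε), ∀ x : ℝ,
        -(deriv (fun s => u s x) t) + (1/2) * (deriv (fun y => u t y) x)^2
          = (m t x) ^ θ) →
      (∀ t ∈ Icc t₀ (2*t₀+ε), ∀ x : ℝ, m t x ≤ C₁ * (t + ε) ^ (-α)) →
      (∀ t ∈ Icc t₀ (2*t₀+ε),
        {x : ℝ | 0 < m t x} ⊆ Icc (-(C₁ * (t+ε) ^ α)) (C₁ * (t+ε) ^ α)) →
      c < d →
      ContDiffOn ℝ 1 (fun p : ℝ × ℝ => γ p.1 p.2) (Icc t₀ (2*t₀+ε) ×ˢ Ioo c d) →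
      (∀ t ∈ Icc t₀ (2*t₀+ε), ∀ ξ ∈ Ioo c d,
        HasDerivAt (fun s => γ s ξ) (-(deriv (fun y => u t y) (γ t ξ))) t) →
      (∀ t ∈ Icc t₀ (2*t₀+ε), {x : ℝ | 0 < m t x} = (fun ξ => γ t ξ) '' (Ioo c d)) →
      ∀ t ∈ Icc t₀ (2*t₀+ε), ∀ x : ℝ, 0 < m t x →
        ∀ s ∈ Icc t₀ (2*t₀+ε), ∀ z : ℝ, 0 < m s z →
          u t x - u s z ≤ C * (t₀ + ε) ^ (2*α - 1) := by
  refine ⟨9 * C₁^2 / 2 + C₁^θ, by positivity, ?_⟩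
  intro T _ ε hε t₀ ht₀ u m c d γ hu _ hm0 hHJ hmC hsupp _ _ hγ himg t ht x hx s hs z hz
  have hα0 : 0 < α := by rw [hα]; positivity
  have hα1 : α < 1 := by rw [hα, div_lt_one (by positivity)]; linarith
  have hαθ : -α * θ = 2 * α - 2 := by rw [hα]; field_simp; ring
  obtain ⟨τ, hτ⟩ : ∃ τ, τ = t₀ + ε := ⟨_, rfl⟩
  have hτ0 : 0 < τ := by linarith [hε.1, ht₀.1]
  have hend : 2 * t₀ + ε = t₀ + τ := by linarith
  rw [← hτ]
  rw [hend] at hu hm0 hHJ hmC hsupp hγ himg ht hs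
  have hlt : t₀ < t₀ + τ := by linarith
  have hl : t₀ ∈ Icc t₀ (t₀ + τ) := left_mem_Icc.2 hlt.le
  have hr : t₀ + τ ∈ Icc t₀ (t₀ + τ) := right_mem_Icc.2 hlt.le
  have hsource : ∀ t ∈ Icc t₀ (t₀ + τ), ∀ x, (m t x)^θ ≤ C₁^θ * τ^(2 * α - 2) := by
    intro t ht x
    have h1 : (t + ε)^(-α) ≤ τ^(-α) :=
      Real.rpow_le_rpow_of_nonpos hτ0 (by linarith [ht.1]) (by linarith)
    calc (m t x)^θ ≤ (C₁ * τ^(-α))^θ :=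
          Real.rpow_le_rpow (hm0 t ht x)
            ((hmC t ht x).trans (mul_le_mul_of_nonneg_left h1 hC₁.le)) hθ.le
      _ = C₁^θ * τ^(2 * α - 2) := by
          rw [Real.mul_rpow hC₁.le (by positivity), ← Real.rpow_mul hτ0.le, hαθ]
  have hanti : ∀ ξ ∈ Ioo c d, AntitoneOn (fun s => u s (γ s ξ)) (Icc t₀ (t₀ + τ)) :=
    fun ξ hξ => antitoneOn_along_optimal_trajectory hu hHJ
      (fun t ht x => Real.rpow_nonneg (hm0 t ht x) θ) fun t ht => hγ t ht ξ hξ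
  have hpos : ∀ t ∈ Icc t₀ (t₀ + τ), ∀ ξ ∈ Ioo c d, 0 < m t (γ t ξ) := by
    intro t ht ξ hξ
    have : γ t ξ ∈ {x : ℝ | 0 < m t x} := himg t ht ▸ mem_image_of_mem _ hξ
    exact this
  obtain ⟨ξ, hξ, rfl⟩ : x ∈ (fun ξ => γ t ξ) '' Ioo c d := himg t ht ▸ hx
  obtain ⟨η, hη, rfl⟩ : z ∈ (fun ξ => γ s ξ) '' Ioo c d := himg s hs ▸ hz
  have h1 : u t (γ t ξ) ≤ u t₀ (γ t₀ ξ) := hanti ξ hξ hl ht ht.1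
  have h2 : u (t₀ + τ) (γ (t₀ + τ) η) ≤ u s (γ s η) := hanti η hη hs hr hs.2
  have h3 := sub_le_straight_line_cost hlt hu hHJ hsource (γ (t₀ + τ) η) (γ t₀ ξ)
  rw [add_sub_cancel_left] at h3
  have hξb := hsupp t₀ hl (hpos t₀ hl ξ hξ)
  have hηb := hsupp (t₀ + τ) hr (hpos (t₀ + τ) hr η hη)
  rw [← hτ] at hξb
  have h2α : (t₀ + τ + ε)^α ≤ 2 * τ^α := by
    rw [show t₀ + τ + ε = 2 * τ by linarith, Real.mul_rpow two_pos.le hτ0.le]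
    gcongr
    exact Real.rpow_le_self_of_one_le one_le_two hα1.le
  have h2αC := mul_le_mul_of_nonneg_left h2α hC₁.le
  have hdist : (γ (t₀ + τ) η - γ t₀ ξ)^2 ≤ (3 * C₁ * τ^α)^2 :=
    sq_le_sq' (by linarith [hξb.2, hηb.1]) (by linarith [hξb.1, hηb.2])
  have hkin : (3 * C₁ * τ^α)^2 / (2 * τ) = 9 * C₁^2 / 2 * τ^(2 * α - 1) := by
    rw [Real.rpow_sub_one hτ0.ne', mul_comm 2 α, Real.rpow_mul hτ0.le, Real.rpow_two]
    field_simp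
    ring
  have hpot : C₁^θ * τ^(2 * α - 2) * τ = C₁^θ * τ^(2 * α - 1) := by
    rw [mul_assoc, ← Real.rpow_add_one hτ0.ne']
    ring_nf
  have hdiv := div_le_div_of_nonneg_right hdist (by positivity : (0:ℝ) ≤ 2 * τ)
  linarith
end

section
/- Let θ>0, α := 2/(2+θ), and let R_α, φ be as in the context. Let C₁ ≥ 1 and let γ : [−R_α,R_α] → ℝ be continuously differentiable with C₁^{−1} ≤ γ'(y) ≤ C₁ and |γ(y) − y| ≤ R_α/4 for all y. Define μ : ℝ → [0,∞) by μ(x) := φ(γ^{−1}(x)) / γ'(γ^{−1}(x)) for x ∈ γ([−R_α,R_α]) and μ(x) := 0 otherwise (so that μ is the density of γ_♯(φ dy)). Then there exists C>0, depending only on θ and C₁, such that for every continuously differentiable f : ℝ → ℝ with bounded derivative: | ∫_ℝ f(x)(μ(x) − φ(x)) dx | ≤ C ( ∫_ℝ f'(x)² (μ(x)+φ(x)) dx )^{1/2} ( ∫_{−R_α}^{R_α} (γ(y)−y)² φ(y) dy )^{1/2}. -/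
open MeasureTheory Set

lemma abs_integral_mul_le_sqrt_mul_sqrt {X : Type*} [MeasurableSpace X] {ν : Measure X}
    {F G : X → ℝ} (hF : MemLp F 2 ν) (hG : MemLp G 2 ν) :
    |∫ x, F x * G x ∂ν| ≤ √(∫ x, F x ^ 2 ∂ν) * √(∫ x, G x ^ 2 ∂ν) := by
  have h := integral_mul_norm_le_Lp_mul_Lq (μ := ν) (f := F) (g := G)
    Real.HolderConjugate.two_two (by simpa using hF) (by simpa using hG)
  simp only [Real.norm_eq_abs, Real.rpow_two, sq_abs, ← Real.sqrt_eq_rpow] at h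
  refine le_trans ?_ h
  simpa [abs_mul] using abs_integral_le_integral_abs (μ := ν) (f := fun x => F x * G x)

lemma barenblatt_comparison {k R p : ℝ} (hk : 0 < k) (hp : 0 < p) {y z : ℝ}
    (h : z ^ 2 ≤ y ^ 2 ∨ z ^ 2 ≤ R ^ 2 / 4) :
    (3 / 4 : ℝ) ^ p * (max (k * (R ^ 2 - y ^ 2)) 0) ^ p ≤ (max (k * (R ^ 2 - z ^ 2)) 0) ^ p := by
  rw [← Real.mul_rpow (by norm_num) (le_max_right _ _)]
  refine Real.rpow_le_rpow (by positivity) ?_ hp.le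
  rcases le_total (k * (R ^ 2 - y ^ 2)) 0 with h0 | h0
  · simp [max_eq_right h0]
  · rw [max_eq_left h0]
    refine le_trans ?_ (le_max_left _ _)
    rcases h with h | h
    · nlinarith
    · nlinarith [mul_le_mul_of_nonneg_left h hk.le, mul_nonneg hk.le (sq_nonneg y)]

/-- Along the segment from `y` to `γ y`, the value `φ y` is controlled by the sum of `φ` and the
density of the pushforward of `φ` under `γ`. -/
lemma le_add_density_of_mem_segment {R c C₁ : ℝ} (hR : 0 < R) (hc : 0 ≤ c) (hC₁ : 1 ≤ C₁)
    {φ γ γ' μ : ℝ → ℝ} (hφ0 : ∀ x, 0 ≤ φ x)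
    (hcmp : ∀ y z, (z ^ 2 ≤ y ^ 2 ∨ z ^ 2 ≤ R ^ 2 / 4) → c * φ y ≤ φ z)
    (hγc : ContinuousOn γ (Icc (-R) R))
    (hγ' : ∀ y ∈ Icc (-R) R, 0 < γ' y ∧ γ' y ≤ C₁)
    (hγ : ∀ y ∈ Icc (-R) R, |γ y - y| ≤ R / 4)
    (hμ0 : ∀ x, 0 ≤ μ x) (hμ : ∀ y ∈ Icc (-R) R, μ (γ y) = φ y / γ' y)
    {x y : ℝ} (hy : y ∈ Icc (-R) R) (hx : x ∈ uIcc y (γ y)) :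
    c / C₁ * φ y ≤ μ x + φ x := by
  have hC₁0 : 0 < C₁ := by linarith
  have hcφ : c / C₁ * φ y ≤ c * φ y :=
    mul_le_mul_of_nonneg_right (div_le_self hc hC₁) (hφ0 y)
  by_cases hxy : x ^ 2 ≤ y ^ 2
  · linarith [hcmp y x (Or.inl hxy), hμ0 x]
  have key : ∀ z ∈ Icc (-R) R, γ z = x → (z ^ 2 ≤ y ^ 2 ∨ z ^ 2 ≤ R ^ 2 / 4) →
      c / C₁ * φ y ≤ μ x + φ x := by
    intro z hz hzx h
    have h1 : φ z / C₁ ≤ φ z / γ' z :=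
      div_le_div_of_nonneg_left (hφ0 z) (hγ' z hz).1 (hγ' z hz).2
    have h2 : c / C₁ * φ y ≤ φ z / C₁ := by
      rw [div_mul_eq_mul_div]
      exact div_le_div_of_nonneg_right (hcmp y z h) hC₁0.le
    rw [← hzx, hμ z hz]
    linarith [hφ0 (γ z)]
  have hyγ := abs_le.1 (hγ y hy)
  push Not at hxy
  obtain ⟨hy1, hy2⟩ := hy
  rcases le_total y (γ y) with h | h
  · rw [uIcc_of_le h] at hx
    obtain ⟨hx1, hx2⟩ := hx
    have hx0 : 0 < x := by
      by_contra hx0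
      nlinarith
    have hl := abs_le.1 (hγ (-R) ⟨le_rfl, by linarith⟩)
    obtain ⟨z, ⟨hz1, hz2⟩, hzx⟩ := intermediate_value_Icc hy1
      (hγc.mono (Icc_subset_Icc_right hy2)) (show x ∈ Icc (γ (-R)) (γ y) from ⟨by linarith, hx2⟩)
    have hzR : z ∈ Icc (-R) R := ⟨hz1, hz2.trans hy2⟩
    have hzγ := abs_le.1 (hγ z hzR)
    refine key z hzR hzx ?_
    rcases le_total 0 z with h0 | h0
    · left; nlinarith
    · right; nlinarith
  · rw [uIcc_of_ge h] at hx
    obtain ⟨hx1, hx2⟩ := hx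
    have hx0 : x < 0 := by
      by_contra hx0
      nlinarith
    have hl := abs_le.1 (hγ R ⟨by linarith, le_rfl⟩)
    obtain ⟨z, ⟨hz1, hz2⟩, hzx⟩ := intermediate_value_Icc hy2
      (hγc.mono (Icc_subset_Icc_left hy1)) (show x ∈ Icc (γ y) (γ R) from ⟨hx1, by linarith⟩)
    have hzR : z ∈ Icc (-R) R := ⟨hy1.trans hz1, hz2⟩
    have hzγ := abs_le.1 (hγ z hzR)
    refine key z hzR hzx ?_
    rcases le_total z 0 with h0 | h0
    · left; nlinarith
    · right; nlinarith

lemma injOn_Icc_of_hasDerivAt_pos {a b : ℝ} {T T' : ℝ → ℝ}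
    (hT : ∀ y ∈ Icc a b, HasDerivAt T (T' y) y) (hpos : ∀ y ∈ Icc a b, 0 < T' y) :
    InjOn T (Icc a b) := by
  refine (strictMonoOn_of_deriv_pos (convex_Icc a b)
    (fun y hy => (hT y hy).continuousAt.continuousWithinAt) fun y hy => ?_).injOn
  rw [(hT y (interior_subset hy)).deriv]
  exact hpos y (interior_subset hy)

/-- Composition with a map of derivative at least `m` costs a factor `m⁻¹` in the integral. -/
lemma integrableOn_comp_and_setIntegral_comp_le {a b m : ℝ} (hm : 0 < m) {T T' g : ℝ → ℝ}
    (hT : ∀ y ∈ Icc a b, HasDerivAt T (T' y) y) (hT'c : ContinuousOn T' (Icc a b))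
    (hT' : ∀ y ∈ Icc a b, m ≤ T' y) (hg0 : ∀ x, 0 ≤ g x) (hg : Integrable g) :
    IntegrableOn (fun y => g (T y)) (Icc a b) ∧
      ∫ y in Icc a b, g (T y) ≤ m⁻¹ * ∫ x, g x := by
  have hpos : ∀ y ∈ Icc a b, 0 < T' y := fun y hy => hm.trans_le (hT' y hy)
  have hinj := injOn_Icc_of_hasDerivAt_pos hT hpos
  have hTw : ∀ y ∈ Icc a b, HasDerivWithinAt T (T' y) (Icc a b) y :=
    fun y hy => (hT y hy).hasDerivWithinAt
  have hi : IntegrableOn (fun y => |T' y| • g (T y)) (Icc a b) :=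
    (integrableOn_image_iff_integrableOn_abs_deriv_smul measurableSet_Icc hTw hinj g).1
      hg.integrableOn
  have hmul : IntegrableOn (fun y => (T' y)⁻¹ * (|T' y| • g (T y))) (Icc a b) :=
    hi.continuousOn_mul (hT'c.inv₀ fun y hy => (hpos y hy).ne') isCompact_Icc
  have hcomp : IntegrableOn (fun y => g (T y)) (Icc a b) := by
    refine hmul.congr_fun (fun y hy => ?_) measurableSet_Icc
    have := hpos y hy
    simp only [smul_eq_mul, abs_of_pos this]
    field_simp
  refine ⟨hcomp, ?_⟩
  calc ∫ y in Icc a b, g (T y) ≤ ∫ y in Icc a b, m⁻¹ * (|T' y| • g (T y)) := by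
        refine setIntegral_mono_on hcomp (hi.const_mul _) measurableSet_Icc fun y hy => ?_
        have h1 : 1 ≤ m⁻¹ * T' y := by
          rw [← inv_mul_cancel₀ hm.ne']
          exact mul_le_mul_of_nonneg_left (hT' y hy) (inv_pos.2 hm).le
        rw [abs_of_pos (hpos y hy), smul_eq_mul, ← mul_assoc]
        exact le_mul_of_one_le_left (hg0 _) h1
    _ = m⁻¹ * ∫ x in T '' Icc a b, g x := by
        rw [integral_const_mul,
          integral_image_eq_integral_abs_deriv_smul measurableSet_Icc hTw hinj]
    _ ≤ m⁻¹ * ∫ x, g x := by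
        refine mul_le_mul_of_nonneg_left ?_ (inv_pos.2 hm).le
        exact setIntegral_le_integral hg (ae_of_all _ hg0)

/-- Integrals against the density `μ` of the pushforward of `φ` under `γ`. -/
lemma integrable_mul_density_and_integral_eq {a b : ℝ} {φ γ γ' μ h : ℝ → ℝ}
    (hφ : ContinuousOn φ (Icc a b))
    (hγ : ∀ y ∈ Icc a b, HasDerivAt γ (γ' y) y) (hγ' : ∀ y ∈ Icc a b, 0 < γ' y)
    (hμ0 : ∀ x, x ∉ γ '' Icc a b → μ x = 0) (hμ : ∀ y ∈ Icc a b, μ (γ y) = φ y / γ' y)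
    (hh : Continuous h) :
    Integrable (fun x => h x * μ x) ∧
      ∫ x, h x * μ x = ∫ y in Icc a b, h (γ y) * φ y := by
  have hinj := injOn_Icc_of_hasDerivAt_pos hγ hγ'
  have hγw : ∀ y ∈ Icc a b, HasDerivWithinAt γ (γ' y) (Icc a b) y :=
    fun y hy => (hγ y hy).hasDerivWithinAt
  have hγc : ContinuousOn γ (Icc a b) := fun y hy => (hγw y hy).continuousWithinAt
  have heq : EqOn (fun y => h (γ y) * φ y) (fun y => |γ' y| • (h (γ y) * μ (γ y)))
      (Icc a b) := by
    intro y hy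
    have := hγ' y hy
    simp only [smul_eq_mul, abs_of_pos this, hμ y hy]
    field_simp
  have hsupp : ∀ x, x ∉ γ '' Icc a b → h x * μ x = 0 := fun x hx => by simp [hμ0 x hx]
  constructor
  · refine (integrableOn_iff_integrable_of_support_subset fun x hx => ?_).1
      ((integrableOn_image_iff_integrableOn_abs_deriv_smul measurableSet_Icc hγw hinj
        fun x => h x * μ x).2 (IntegrableOn.congr_fun ?_ heq measurableSet_Icc))
    · by_contra hx'
      exact hx (hsupp x hx')
    · exact ((hh.comp_continuousOn hγc).mul hφ).integrableOn_Icc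
  · rw [← setIntegral_eq_integral_of_forall_compl_eq_zero hsupp,
      integral_image_eq_integral_abs_deriv_smul measurableSet_Icc hγw hinj]
    exact (setIntegral_congr_fun measurableSet_Icc heq).symm

/-- Differentiation of an integral along displacement interpolation, combined with the mean value
inequality. -/
lemma abs_setIntegral_comp_sub_le {a b M B : ℝ} {φ γ f f' : ℝ → ℝ}
    (hφ : ContinuousOn φ (Icc a b)) (hγ : ContinuousOn γ (Icc a b))
    (hf : ∀ x, HasDerivAt f (f' x) x) (hM : ∀ x, |f' x| ≤ M)
    (hB : ∀ s ∈ Icc (0 : ℝ) 1,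
      |∫ y in Icc a b, f' (y + s * (γ y - y)) * (γ y - y) * φ y| ≤ B) :
    |∫ y in Icc a b, (f (γ y) - f y) * φ y| ≤ B := by
  have hfc : Continuous f := continuous_iff_continuousAt.2 fun x => (hf x).continuousAt
  have hf'm : Measurable f' := by
    rw [show f' = deriv f from funext fun x => (hf x).deriv.symm]
    exact measurable_deriv f
  have hTc : ∀ s : ℝ, ContinuousOn (fun y => y + s * (γ y - y)) (Icc a b) :=
    fun s => continuousOn_id.add (continuousOn_const.mul (hγ.sub continuousOn_id))
  have hint : ∀ s : ℝ, IntegrableOn (fun y => f (y + s * (γ y - y)) * φ y) (Icc a b) :=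
    fun s => ((hfc.comp_continuousOn (hTc s)).mul hφ).integrableOn_Icc
  have hd : ContinuousOn (fun y => γ y - y) (Icc a b) := hγ.sub continuousOn_id
  have hderiv : ∀ s : ℝ, HasDerivAt (fun s => ∫ y in Icc a b, f (y + s * (γ y - y)) * φ y)
      (∫ y in Icc a b, f' (y + s * (γ y - y)) * (γ y - y) * φ y) s := by
    intro s
    refine (hasDerivAt_integral_of_dominated_loc_of_deriv_le (μ := volume.restrict (Icc a b))
      (F := fun s y => f (y + s * (γ y - y)) * φ y)
      (F' := fun s y => f' (y + s * (γ y - y)) * (γ y - y) * φ y)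
      (bound := fun y => M * |γ y - y| * |φ y|) (s := univ) Filter.univ_mem
      (Filter.Eventually.of_forall fun t => (hint t).aestronglyMeasurable) (hint s) ?_ ?_ ?_ ?_).2
    · exact ((hf'm.comp_aemeasurable ((hTc s).aemeasurable measurableSet_Icc)).mul
        (hd.aemeasurable measurableSet_Icc)).mul
        (hφ.aemeasurable measurableSet_Icc) |>.aestronglyMeasurable
    · refine ae_of_all _ fun y t _ => ?_
      simp only [Real.norm_eq_abs, abs_mul]
      gcongr
      exact hM _
    · exact ((continuousOn_const.mul hd.abs).mul hφ.abs).integrableOn_Icc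
    · refine ae_of_all _ fun y t _ => ?_
      have h1 : HasDerivAt (fun t : ℝ => y + t * (γ y - y)) (γ y - y) t := by
        simpa using ((hasDerivAt_id t).mul_const (γ y - y)).const_add y
      exact ((hf _).comp t h1).mul_const (φ y)
  have hmv := norm_image_sub_le_of_norm_deriv_le_segment_01'
    (fun s _ => (hderiv s).hasDerivWithinAt)
    (fun s hs => hB s (Ico_subset_Icc_self hs))
  rw [← integral_sub (hint 1) (hint 0)] at hmv
  simpa [sub_mul] using hmv

theorem stmt_11 (θ : ℝ) (hθ : 0 < θ)
    (α : ℝ) (hα : α = 2 / (2 + θ))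
    (R : ℝ) (hR : 0 < R)
    (φ : ℝ → ℝ)
    (hφ : ∀ r, φ r = (max ((1/2) * α * (1 - α) * (R^2 - r^2)) 0) ^ (1/θ))
    (hφint : (∫ r : ℝ, φ r) = 1)
    (C₁ : ℝ) (hC₁ : 1 ≤ C₁) :
    ∃ C > 0, ∀ γ γ' μ : ℝ → ℝ,
      (∀ y ∈ Icc (-R) R, HasDerivAt γ (γ' y) y) →
      ContinuousOn γ' (Icc (-R) R) →
      (∀ y ∈ Icc (-R) R, C₁⁻¹ ≤ γ' y ∧ γ' y ≤ C₁) →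
      (∀ y ∈ Icc (-R) R, |γ y - y| ≤ R/4) →
      (∀ x, 0 ≤ μ x) →
      (∀ x, x ∉ γ '' (Icc (-R) R) → μ x = 0) →
      (∀ y ∈ Icc (-R) R, μ (γ y) = φ y / γ' y) →
      ∀ f f' : ℝ → ℝ,
        (∀ x, HasDerivAt f (f' x) x) →
        (∃ M, ∀ x, |f' x| ≤ M) →
        |∫ x : ℝ, f x * (μ x - φ x)| ≤
          C * Real.sqrt (∫ x : ℝ, (f' x)^2 * (μ x + φ x)) *
            Real.sqrt (∫ y in Icc (-R) R, (γ y - y)^2 * φ y) := by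
  have hC₁0 : 0 < C₁ := by linarith
  have hθ' : 0 < 1 / θ := by positivity
  have hk : 0 < 1 / 2 * α * (1 - α) := by
    have h1 : 1 - α = θ / (2 + θ) := by rw [hα]; field_simp; ring
    rw [h1, hα]; positivity
  have hφ0 : ∀ x, 0 ≤ φ x := fun x => by rw [hφ]; positivity
  have hφc : Continuous φ := by
    rw [funext hφ]
    exact Continuous.rpow_const (by fun_prop) fun x => Or.inr hθ'.le
  have hφs : ∀ x, x ∉ Icc (-R) R → φ x = 0 := by
    intro x hx
    have h1 : R ^ 2 - x ^ 2 ≤ 0 := by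
      by_contra h
      exact hx (abs_le.1 (abs_le_of_sq_le_sq (by linarith) hR.le))
    rw [hφ, max_eq_right (mul_nonpos_of_nonneg_of_nonpos hk.le h1), Real.zero_rpow hθ'.ne']
  obtain ⟨c, hc, hcmp⟩ : ∃ c > 0, ∀ y z, (z ^ 2 ≤ y ^ 2 ∨ z ^ 2 ≤ R ^ 2 / 4) →
      c * φ y ≤ φ z :=
    ⟨(3 / 4 : ℝ) ^ (1 / θ), by positivity, fun y z h => by
      rw [hφ, hφ]; exact barenblatt_comparison hk hθ' h⟩
  refine ⟨√(C₁ / c * C₁), by positivity, ?_⟩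
  rintro γ γ' μ hγd hγ'c hγ' hγ hμ0 hμs hμ f f' hf ⟨M, hM⟩
  have hγ'0 : ∀ y ∈ Icc (-R) R, 0 < γ' y :=
    fun y hy => (inv_pos.2 hC₁0).trans_le (hγ' y hy).1
  have hγc : ContinuousOn γ (Icc (-R) R) :=
    fun y hy => (hγd y hy).continuousAt.continuousWithinAt
  have hfc : Continuous f := continuous_iff_continuousAt.2 fun x => (hf x).continuousAt
  have hf'm : Measurable f' := by
    rw [show f' = deriv f from funext fun x => (hf x).deriv.symm]
    exact measurable_deriv f
  have hφi : ∀ h : ℝ → ℝ, Continuous h → Integrable fun x => h x * φ x := fun h hh =>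
    (integrableOn_iff_integrable_of_support_subset (s := Icc (-R) R) fun x hx => by
      by_contra hx'
      exact hx (by simp [hφs x hx'])).1 (hh.mul hφc).continuousOn.integrableOn_Icc
  have hpush := fun h hh => integrable_mul_density_and_integral_eq (h := h) hφc.continuousOn
    hγd hγ'0 hμs hμ hh
  have hsum : Integrable fun x => μ x + φ x := by
    simpa only [one_mul] using
      Integrable.fun_add (hpush (fun _ => 1) continuous_const).1 (hφi (fun _ => 1) continuous_const)
  have henergy : Integrable fun x => f' x ^ 2 * (μ x + φ x) := by
    refine hsum.bdd_mul (c := M ^ 2) (hf'm.pow_const 2).aestronglyMeasurable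
      (ae_of_all _ fun x => ?_)
    simpa using pow_le_pow_left₀ (abs_nonneg _) (hM x) 2
  have hsplit : ∫ x, f x * (μ x - φ x) = ∫ y in Icc (-R) R, (f (γ y) - f y) * φ y := by
    simp only [mul_sub, sub_mul]
    rw [integral_sub (hpush f hfc).1 (hφi f hfc), (hpush f hfc).2,
      ← setIntegral_eq_integral_of_forall_compl_eq_zero
        (fun x hx => by rw [hφs x hx, mul_zero] : ∀ x, x ∉ Icc (-R) R → f x * φ x = 0),
      integral_sub (f := fun y => f (γ y) * φ y)
        ((hfc.comp_continuousOn hγc).mul hφc.continuousOn).integrableOn_Icc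
        (hφi f hfc).integrableOn]
  rw [hsplit]
  refine abs_setIntegral_comp_sub_le hφc.continuousOn hγc hf hM fun s hs => ?_
  obtain ⟨hs0, hs1⟩ := hs
  have hTd : ∀ y ∈ Icc (-R) R,
      HasDerivAt (fun y => y + s * (γ y - y)) (1 + s * (γ' y - 1)) y := fun y hy =>
    (hasDerivAt_id y).add (((hγd y hy).sub (hasDerivAt_id y)).const_mul s)
  have hTc : ContinuousOn (fun y => y + s * (γ y - y)) (Icc (-R) R) :=
    fun y hy => (hTd y hy).continuousAt.continuousWithinAt
  have hC₁i : C₁⁻¹ ≤ 1 := inv_le_one_of_one_le₀ hC₁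
  obtain ⟨hcompi, hcomp⟩ := integrableOn_comp_and_setIntegral_comp_le (inv_pos.2 hC₁0) hTd
    (by fun_prop) (fun y hy => by nlinarith [(hγ' y hy).1])
    (fun x => mul_nonneg (sq_nonneg (f' x)) (add_nonneg (hμ0 x) (hφ0 x))) henergy
  rw [inv_inv] at hcomp
  have hsqrt : Continuous fun y => √(φ y) := Real.continuous_sqrt.comp hφc
  have hsq : ContinuousOn (fun y => √(φ y)) (Icc (-R) R) := hsqrt.continuousOn
  have hGc : ContinuousOn (fun y => (γ y - y) * √(φ y)) (Icc (-R) R) :=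
    (hγc.sub continuousOn_id).mul hsq
  have hG : MemLp (fun y => (γ y - y) * √(φ y)) 2 (volume.restrict (Icc (-R) R)) :=
    (memLp_two_iff_integrable_sq (hGc.aestronglyMeasurable measurableSet_Icc)).2
      (hGc.pow 2).integrableOn_Icc
  have hS : MemLp (fun y => √(φ y)) 2 (volume.restrict (Icc (-R) R)) :=
    (memLp_two_iff_integrable_sq (hsq.aestronglyMeasurable measurableSet_Icc)).2
      (hsq.pow 2).integrableOn_Icc
  have hFm : AEStronglyMeasurable (fun y => f' (y + s * (γ y - y)) * √(φ y))
      (volume.restrict (Icc (-R) R)) :=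
    ((hf'm.comp_aemeasurable (hTc.aemeasurable measurableSet_Icc)).mul
      (hsq.aemeasurable measurableSet_Icc)).aestronglyMeasurable
  have hF : MemLp (fun y => f' (y + s * (γ y - y)) * √(φ y)) 2
      (volume.restrict (Icc (-R) R)) := by
    refine (hS.const_mul M).of_le hFm (ae_of_all _ fun y => ?_)
    simp only [norm_mul, Real.norm_eq_abs]
    exact mul_le_mul_of_nonneg_right ((hM _).trans (le_abs_self M)) (abs_nonneg _)
  have hCS := abs_integral_mul_le_sqrt_mul_sqrt hF hG
  have hprod : ∀ y, f' (y + s * (γ y - y)) * √(φ y) * ((γ y - y) * √(φ y)) =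
      f' (y + s * (γ y - y)) * (γ y - y) * φ y := fun y => by
    linear_combination (f' (y + s * (γ y - y)) * (γ y - y)) * Real.mul_self_sqrt (hφ0 y)
  have hFi := hF.integrable_sq
  simp only [hprod, mul_pow, Real.sq_sqrt (hφ0 _)] at hCS hFi
  refine hCS.trans (mul_le_mul_of_nonneg_right ?_ (Real.sqrt_nonneg _))
  rw [← Real.sqrt_mul (by positivity)]
  refine Real.sqrt_le_sqrt ?_
  have hpoint : ∀ y ∈ Icc (-R) R, f' (y + s * (γ y - y)) ^ 2 * φ y ≤
      C₁ / c * (f' (y + s * (γ y - y)) ^ 2 *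
        (μ (y + s * (γ y - y)) + φ (y + s * (γ y - y)))) := by
    intro y hy
    have hmem : y + s * (γ y - y) ∈ uIcc y (γ y) := by
      rw [← segment_eq_uIcc, segment_eq_image']
      exact ⟨s, ⟨hs0, hs1⟩, rfl⟩
    have h1 := le_add_density_of_mem_segment hR hc.le hC₁ hφ0 hcmp hγc
      (fun y hy => ⟨hγ'0 y hy, (hγ' y hy).2⟩) hγ hμ0 hμ hy hmem
    have h2 : φ y = C₁ / c * (c / C₁ * φ y) := by field_simp
    rw [h2, mul_left_comm]
    gcongr
  calc ∫ y in Icc (-R) R, f' (y + s * (γ y - y)) ^ 2 * φ y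
      ≤ ∫ y in Icc (-R) R, C₁ / c * (f' (y + s * (γ y - y)) ^ 2 *
        (μ (y + s * (γ y - y)) + φ (y + s * (γ y - y)))) :=
        setIntegral_mono_on hFi (hcompi.const_mul _) measurableSet_Icc hpoint
    _ ≤ C₁ / c * (C₁ * ∫ x, f' x ^ 2 * (μ x + φ x)) := by
        rw [integral_const_mul]
        gcongr
    _ = C₁ / c * C₁ * ∫ x, f' x ^ 2 * (μ x + φ x) := by ring
end

section
/- Let θ>0, α := 2/(2+θ), and let R_α, φ be as in the context. Let K>0 and let γ : [−R_α,R_α] → ℝ be continuously differentiable and strictly increasing with 0 < γ'(y) ≤ K for all y. Define μ on [γ(−R_α), γ(R_α)] by μ(γ(y)) := φ(y)/γ'(y). Then ∫_{γ(−R_α)}^{γ(R_α)} μ(η)^{1−θ} dη ≤ K^{θ} ∫_{−R_α}^{R_α} φ(y)^{1−θ} dy, and this bound is finite. -/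
open MeasureTheory Set

/-- Powers above `-1` of `R ^ 2 - r ^ 2` are integrable on `(-R, R)`. -/
lemma integrableOn_sq_sub_sq_rpow {R p : ℝ} (hR : 0 < R) (hp : -1 < p) :
    IntegrableOn (fun r : ℝ => (R ^ 2 - r ^ 2) ^ p) (Ioo (-R) R) := by
  have hminus : IntervalIntegrable (fun r : ℝ => (R - r) ^ p) volume 0 R := by
    have h := (intervalIntegral.intervalIntegrable_rpow' (a := R) (b := 0) hp).comp_sub_left R
    simpa using h
  have hplus : IntervalIntegrable (fun r : ℝ => (R + r) ^ p) volume (-R) 0 := by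
    have h := (intervalIntegral.intervalIntegrable_rpow' (a := 0) (b := R) hp).comp_add_left R
    simpa using h
  have hright : IntervalIntegrable (fun r : ℝ => (R - r) ^ p * (R + r) ^ p) volume 0 R := by
    refine hminus.mul_continuousOn (ContinuousOn.rpow_const (by fun_prop) ?_)
    intro r hr
    rw [uIcc_of_le hR.le] at hr
    exact Or.inl (by linarith [hr.1])
  have hleft : IntervalIntegrable (fun r : ℝ => (R - r) ^ p * (R + r) ^ p) volume (-R) 0 := by
    refine hplus.continuousOn_mul (ContinuousOn.rpow_const (by fun_prop) ?_)
    intro r hr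
    rw [uIcc_of_le (by linarith)] at hr
    exact Or.inl (by linarith [hr.2])
  have h := (intervalIntegrable_iff_integrableOn_Ioo_of_le (by linarith)).1 (hleft.trans hright)
  refine h.congr_fun (fun r hr => ?_) measurableSet_Ioo
  have h1 : 0 ≤ R - r := by linarith [hr.2]
  have h2 : 0 ≤ R + r := by linarith [hr.1]
  change (R - r) ^ p * (R + r) ^ p = (R ^ 2 - r ^ 2) ^ p
  rw [← Real.mul_rpow h1 h2]
  ring_nf

/-- A continuous strictly monotone function maps an open interval onto an open interval. -/
lemma StrictMonoOn.image_Ioo_eq {f : ℝ → ℝ} {a b : ℝ} (hab : a ≤ b)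
    (hf : StrictMonoOn f (Icc a b)) (hc : ContinuousOn f (Icc a b)) :
    f '' Ioo a b = Ioo (f a) (f b) := by
  refine Subset.antisymm ?_ (intermediate_value_Ioo hab hc)
  rintro _ ⟨x, hx, rfl⟩
  exact ⟨hf (left_mem_Icc.2 hab) (Ioo_subset_Icc_self hx) hx.1,
    hf (Ioo_subset_Icc_self hx) (right_mem_Icc.2 hab) hx.2⟩

/-- non-degeneracy integral estimate ∫ μ^{1−θ} ≤ K^θ ∫ φ^{1−θ} < ∞
for the pushforward density μ = γ_♯(φ dy) in Lagrangian coordinates. -/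
theorem stmt_13 (θ : ℝ) (hθ : 0 < θ)
    (α : ℝ) (hα : α = 2 / (2 + θ))
    (R : ℝ) (hR : 0 < R)
    (φ : ℝ → ℝ)
    (hφ : ∀ r, φ r = (max ((1/2) * α * (1 - α) * (R^2 - r^2)) 0) ^ (1/θ))
    (hφint : (∫ r : ℝ, φ r) = 1)
    (K : ℝ) (hK : 0 < K)
    (γ γ' μ : ℝ → ℝ)
    (hderiv : ∀ y ∈ Icc (-R) R, HasDerivAt γ (γ' y) y)
    (hcont : ContinuousOn γ' (Icc (-R) R))
    (hmono : StrictMonoOn γ (Icc (-R) R))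
    (hγ' : ∀ y ∈ Icc (-R) R, 0 < γ' y ∧ γ' y ≤ K)
    (hμ : ∀ y ∈ Icc (-R) R, μ (γ y) = φ y / γ' y) :
    IntegrableOn (fun y => (φ y) ^ (1-θ)) (Ioo (-R) R) volume ∧
    IntegrableOn (fun η => (μ η) ^ (1-θ)) (Ioo (γ (-R)) (γ R)) volume ∧
    (∫ η in (γ (-R))..(γ R), (μ η) ^ (1-θ)) ≤ K ^ θ * ∫ y in (-R)..R, (φ y) ^ (1-θ) := by
  have hα0 : 0 < α := by rw [hα]; positivity
  have hα1 : α < 1 := by rw [hα, div_lt_one (by positivity)]; linarith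
  have hc : 0 < 1 / 2 * α * (1 - α) := mul_pos (by positivity) (by linarith)
  set c := 1 / 2 * α * (1 - α)
  have hRR : -R ≤ R := by linarith
  have hsq : ∀ r ∈ Ioo (-R) R, 0 < R ^ 2 - r ^ 2 := fun r hr => by nlinarith [hr.1, hr.2]
  have hφpos : ∀ r ∈ Ioo (-R) R, 0 < φ r := fun r hr => by
    rw [hφ]
    exact Real.rpow_pos_of_pos (lt_max_of_lt_left (mul_pos hc (hsq r hr))) _
  have hp : -1 < 1 / θ * (1 - θ) := by
    have h : 1 / θ * (1 - θ) = 1 / θ - 1 := by field_simp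
    have : 0 < 1 / θ := by positivity
    linarith
  have hφI : IntegrableOn (fun y => (φ y) ^ (1 - θ)) (Ioo (-R) R) := by
    refine IntegrableOn.congr_fun
      ((integrableOn_sq_sub_sq_rpow hR hp).const_mul (c ^ (1 / θ * (1 - θ))))
      (fun r hr => ?_) measurableSet_Ioo
    have h := mul_pos hc (hsq r hr)
    change c ^ (1 / θ * (1 - θ)) * (R ^ 2 - r ^ 2) ^ (1 / θ * (1 - θ)) = φ r ^ (1 - θ)
    rw [hφ, max_eq_left h.le, ← Real.rpow_mul h.le, Real.mul_rpow hc.le (hsq r hr).le]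
  have hγc : ContinuousOn γ (Icc (-R) R) := fun y hy =>
    (hderiv y hy).continuousAt.continuousWithinAt
  have himage := hmono.image_Ioo_eq hRR hγc
  have hderiv' : ∀ y ∈ Ioo (-R) R, HasDerivWithinAt γ (γ' y) (Ioo (-R) R) y := fun y hy =>
    (hderiv y (Ioo_subset_Icc_self hy)).hasDerivWithinAt
  have hinj : InjOn γ (Ioo (-R) R) := hmono.injOn.mono Ioo_subset_Icc_self
  have hpull : EqOn (fun y => φ y ^ (1 - θ) * γ' y ^ θ)
      (fun y => |γ' y| • μ (γ y) ^ (1 - θ)) (Ioo (-R) R) := fun y hy => by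
    have hy' := Ioo_subset_Icc_self hy
    have hg := (hγ' y hy').1
    have hsplit : γ' y ^ (1 - θ) * γ' y ^ θ = γ' y := by
      rw [← Real.rpow_add hg, sub_add_cancel, Real.rpow_one]
    have hne := (Real.rpow_pos_of_pos hg (1 - θ)).ne'
    simp only [smul_eq_mul]
    rw [abs_of_pos hg, hμ y hy', Real.div_rpow (hφpos y hy).le hg.le, mul_div_assoc',
      eq_div_iff hne]
    linear_combination φ y ^ (1 - θ) * hsplit
  have hprod : IntegrableOn (fun y => φ y ^ (1 - θ) * γ' y ^ θ) (Ioo (-R) R) := by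
    rw [← integrableOn_Icc_iff_integrableOn_Ioo] at hφI ⊢
    exact hφI.mul_continuousOn (hcont.rpow_const fun _ _ => Or.inr hθ.le) isCompact_Icc
  refine ⟨hφI, ?_, ?_⟩
  · rw [← himage, integrableOn_image_iff_integrableOn_abs_deriv_smul measurableSet_Ioo hderiv' hinj]
    exact hprod.congr_fun hpull measurableSet_Ioo
  · have hγR : γ (-R) ≤ γ R :=
      hmono.monotoneOn (left_mem_Icc.2 hRR) (right_mem_Icc.2 hRR) hRR
    rw [intervalIntegral.integral_of_le hγR, intervalIntegral.integral_of_le hRR,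
      integral_Ioc_eq_integral_Ioo, integral_Ioc_eq_integral_Ioo, ← himage,
      integral_image_eq_integral_abs_deriv_smul measurableSet_Ioo hderiv' hinj,
      ← setIntegral_congr_fun measurableSet_Ioo hpull, ← integral_const_mul]
    refine setIntegral_mono_on hprod (hφI.const_mul _) measurableSet_Ioo fun y hy => ?_
    obtain ⟨hg, hgK⟩ := hγ' y (Ioo_subset_Icc_self hy)
    rw [mul_comm]
    exact mul_le_mul_of_nonneg_right (Real.rpow_le_rpow hg.le hgK hθ.le)
      (Real.rpow_nonneg (hφpos y hy).le _)
end

section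
/- Let θ>0, α := 2/(2+θ), and let R_α, φ be as in the context. Let ξ : [−R_α, R_α] → ℝ be continuously differentiable with ξ'(y) ≥ c₀ for all y, for some constant c₀>0, and suppose there exists a constant κ₀ ∈ ℝ such that (α(α−1)/2)·ξ(y)² = φ(y)^θ / ξ'(y)^θ + κ₀ for all y ∈ [−R_α, R_α]. Then ξ(y) = y for all y ∈ [−R_α, R_α]. -/
open MeasureTheory Set

/-- A self-map of `[-R, R]` fixing the endpoints which pushes a continuous density `f`, positive in
the interior, to a constant multiple of itself is the identity, and the constant is `1`. -/
lemma eq_self_of_const_mul_density {R A : ℝ} (hR : 0 < R) {f η η' : ℝ → ℝ} (hf : Continuous f)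
    (hpos : ∀ x ∈ Ioo (-R) R, 0 < f x)
    (hη : ∀ y ∈ Icc (-R) R, HasDerivAt η (η' y) y)
    (hmem : ∀ y ∈ Icc (-R) R, η y ∈ Icc (-R) R)
    (hleft : η (-R) = -R) (hright : η R = R)
    (hdens : ∀ y ∈ Icc (-R) R, A * (f (η y) * η' y) = f y) :
    A = 1 ∧ ∀ y ∈ Icc (-R) R, η y = y := by
  set F : ℝ → ℝ := fun x => ∫ u in (-R)..x, f u with hF
  have hFd : ∀ x, HasDerivAt F (f x) x := fun x =>
    intervalIntegral.integral_hasDerivAt_right (hf.intervalIntegrable _ _)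
      hf.stronglyMeasurable.stronglyMeasurableAtFilter hf.continuousAt
  have hF0 : F (-R) = 0 := intervalIntegral.integral_same
  have hmono : StrictMonoOn F (Icc (-R) R) := by
    apply strictMonoOn_of_deriv_pos (convex_Icc _ _)
    · exact fun x _ => (hFd x).continuousAt.continuousWithinAt
    · intro x hx
      rw [interior_Icc] at hx
      rw [(hFd x).deriv]
      exact hpos x hx
  have hRmem : R ∈ Icc (-R) R := ⟨by linarith, le_rfl⟩
  have hlmem : -R ∈ Icc (-R) R := ⟨le_rfl, by linarith⟩
  have hG : ∀ y ∈ Icc (-R) R, HasDerivAt (fun y => A * F (η y) - F y) 0 y := by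
    intro y hy
    have h := (((hFd (η y)).comp y (hη y hy)).const_mul A).sub (hFd y)
    rw [hdens y hy, sub_self] at h
    exact h
  have hconst : ∀ y ∈ Icc (-R) R, A * F (η y) = F y := by
    intro y hy
    have h := constant_of_has_deriv_right_zero
      (fun y hy => (hG y hy).continuousAt.continuousWithinAt)
      (fun y hy => (hG y (Ico_subset_Icc_self hy)).hasDerivWithinAt) y hy
    simp only [hleft, hF0] at h
    linarith
  have hFR : 0 < F R := hF0 ▸ hmono hlmem hRmem (by linarith)
  have hA : A = 1 := by
    have h := hconst R hRmem
    rw [hright] at h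
    exact mul_right_cancel₀ hFR.ne' (by rw [h, one_mul])
  refine ⟨hA, fun y hy => hmono.injOn (hmem y hy) hy ?_⟩
  simpa [hA] using hconst y hy

/-- a C¹ map ξ with ξ' ≥ c₀ > 0 satisfying the integrated self-similar
ODE (α(α−1)/2)ξ² = φ^θ/(ξ')^θ + κ₀ on [−R_α,R_α] must be the identity. -/
theorem stmt_14 (θ : ℝ) (hθ : 0 < θ)
    (α : ℝ) (hα : α = 2 / (2 + θ))
    (R : ℝ) (hR : 0 < R)
    (φ : ℝ → ℝ)
    (hφ : ∀ r, φ r = (max ((1/2) * α * (1 - α) * (R^2 - r^2)) 0) ^ (1/θ))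
    (hφint : (∫ r : ℝ, φ r) = 1)
    (c₀ : ℝ) (hc₀ : 0 < c₀) (κ₀ : ℝ)
    (ξ ξ' : ℝ → ℝ)
    (hderiv : ∀ y ∈ Icc (-R) R, HasDerivAt ξ (ξ' y) y)
    (hcont : ContinuousOn ξ' (Icc (-R) R))
    (hlb : ∀ y ∈ Icc (-R) R, c₀ ≤ ξ' y)
    (hrel : ∀ y ∈ Icc (-R) R,
      (α*(α-1)/2) * (ξ y)^2 = (φ y) ^ θ / (ξ' y) ^ θ + κ₀) :
    ∀ y ∈ Icc (-R) R, ξ y = y := by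
  have hα0 : 0 < α := by rw [hα]; positivity
  have hα1 : α < 1 := by rw [hα, div_lt_one (by positivity)]; linarith
  have hk : 0 < (1/2) * α * (1 - α) := by
    have : 0 < 1 - α := by linarith
    positivity
  have hRmem : R ∈ Icc (-R) R := ⟨by linarith, le_rfl⟩
  have hlmem : -R ∈ Icc (-R) R := ⟨le_rfl, by linarith⟩
  have hsq : ∀ y ∈ Icc (-R) R, 0 ≤ R^2 - y^2 := fun y hy => by nlinarith [hy.1, hy.2]
  have hφθ : ∀ y ∈ Icc (-R) R, (φ y) ^ θ = (1/2) * α * (1 - α) * (R^2 - y^2) := by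
    intro y hy
    have h0 := mul_nonneg hk.le (hsq y hy)
    rw [hφ, max_eq_left h0, ← Real.rpow_mul h0, one_div_mul_cancel hθ.ne', Real.rpow_one]
  have hpos' : ∀ y ∈ Icc (-R) R, 0 < ξ' y := fun y hy => hc₀.trans_le (hlb y hy)
  have hmono : StrictMonoOn ξ (Icc (-R) R) := by
    apply strictMonoOn_of_deriv_pos (convex_Icc _ _)
    · exact fun x hx => (hderiv x hx).continuousAt.continuousWithinAt
    · intro x hx
      have hx' := interior_subset hx
      rw [(hderiv x hx').deriv]
      exact hpos' x hx'
  have hlt : ξ (-R) < ξ R := hmono hlmem hRmem (by linarith)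
  have hκR : α*(α-1)/2 * (ξ R)^2 = κ₀ := by
    have h := hrel R hRmem
    rw [hφθ R hRmem] at h
    simpa using h
  have hκl : α*(α-1)/2 * (ξ (-R))^2 = κ₀ := by
    have h := hrel (-R) hlmem
    rw [hφθ (-R) hlmem] at h
    simpa using h
  have hodd : ξ (-R) = - ξ R := by
    have h : (ξ (-R))^2 = (ξ R)^2 := by
      apply mul_left_cancel₀ hk.ne'
      linarith
    rcases sq_eq_sq_iff_eq_or_eq_neg.mp h with h | h
    · exact absurd h hlt.ne
    · exact h
  have hL : 0 < ξ R := by linarith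
  obtain ⟨l, hl⟩ : ∃ l, l = ξ R / R := ⟨_, rfl⟩
  have hl0 : 0 < l := by rw [hl]; positivity
  have hξR : ξ R = l * R := by rw [hl]; field_simp
  have hode : ∀ y ∈ Icc (-R) R,
      (R^2 - (ξ y / l)^2) * (l^2 * (ξ' y) ^ θ) = R^2 - y^2 := by
    intro y hy
    have hp : 0 < (ξ' y) ^ θ := Real.rpow_pos_of_pos (hpos' y hy) θ
    have h := hrel y hy
    rw [hφθ y hy, ← hκR, hξR] at h
    field_simp at h ⊢
    apply mul_left_cancel₀ (sub_pos.mpr hα1).ne'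
    linarith
  have hnn : ∀ y ∈ Icc (-R) R, 0 ≤ R^2 - (ξ y / l)^2 := by
    intro y hy
    have hp : 0 < (ξ' y) ^ θ := Real.rpow_pos_of_pos (hpos' y hy) θ
    refine nonneg_of_mul_nonneg_left (b := l^2 * (ξ' y) ^ θ) ?_ (by positivity)
    rw [hode y hy]
    exact hsq y hy
  obtain ⟨hA, hid⟩ := eq_self_of_const_mul_density (A := (l^2) ^ (1/θ) * l) hR
    (f := fun x => (max (R^2 - x^2) 0) ^ (1/θ)) (η := fun y => ξ y / l) (η' := fun y => ξ' y / l)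
    (Continuous.rpow_const (by fun_prop) fun _ => Or.inr (by positivity))
    (fun x hx => Real.rpow_pos_of_pos
      (lt_max_of_lt_left (by nlinarith [hx.1, hx.2])) _)
    (fun y hy => (hderiv y hy).div_const l)
    (fun y hy => abs_le.mp (abs_le_of_sq_le_sq (by linarith [hnn y hy]) hR.le))
    (by simp only [hodd, hξR]; field_simp)
    (by simp only [hξR]; field_simp)
    (by
      intro y hy
      have hp := hpos' y hy
      simp only [max_eq_left (hnn y hy), max_eq_left (hsq y hy)]
      rw [← hode y hy, Real.mul_rpow (hnn y hy) (by positivity),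
        Real.mul_rpow (by positivity) (by positivity), ← Real.rpow_mul hp.le,
        mul_one_div_cancel hθ.ne', Real.rpow_one]
      field_simp)
  have hl1 : l = 1 := by
    rw [← Real.rpow_natCast, ← Real.rpow_mul hl0.le, ← Real.rpow_add_one hl0.ne'] at hA
    exact (Real.rpow_left_inj hl0.le zero_le_one (by positivity)).mp (hA.trans (Real.one_rpow _).symm)
  intro y hy
  simpa [hl1] using hid y hy
end

section
/- Let θ>0, α := 2/(2+θ), and let R_α, φ be as in the context. Let μ : ℝ → [0,∞) be measurable with ∫_ℝ μ = 1, ∫_ℝ μ(η)^{θ+1} dη < ∞ and ∫_ℝ η² μ(η) dη < ∞. Then ∫_ℝ (μ(η) − φ(η)) ( μ(η)^θ + (α(1−α)/2) η² ) dη ≥ ∫_ℝ (μ(η) − φ(η)) ( μ(η)^θ − φ(η)^θ ) dη, and the right-hand side is nonnegative. -/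
open MeasureTheory Set

/-- Real powers with a positive exponent are monotone, in product form. -/
theorem sub_mul_rpow_sub_rpow_nonneg {a b p : ℝ} (ha : 0 ≤ a) (hb : 0 ≤ b) (hp : 0 ≤ p) :
    0 ≤ (a - b) * (a ^ p - b ^ p) := by
  rcases le_total a b with h | h
  · exact mul_nonneg_of_nonpos_of_nonpos (sub_nonpos.2 h)
      (sub_nonpos.2 (Real.rpow_le_rpow ha h hp))
  · exact mul_nonneg (sub_nonneg.2 h) (sub_nonneg.2 (Real.rpow_le_rpow hb h hp))

theorem rpow_le_one_add_rpow_add_one {a p : ℝ} (ha : 0 ≤ a) (hp : 0 ≤ p) :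
    a ^ p ≤ 1 + a ^ (p + 1) := by
  rcases le_total a 1 with h | h
  · linarith [Real.rpow_le_one ha h hp, Real.rpow_nonneg ha (p + 1)]
  · linarith [Real.rpow_le_rpow_of_exponent_le h (by linarith : p ≤ p + 1)]

/-- A continuous compactly supported weight times `μ ^ p` is integrable when `μ ^ (p + 1)` is. -/
theorem integrable_mul_rpow_of_hasCompactSupport {φ μ : ℝ → ℝ} {p : ℝ} (hp : 0 ≤ p)
    (hφ : Continuous φ) (hφs : HasCompactSupport φ) (hmeas : Measurable μ) (hnn : ∀ x, 0 ≤ μ x)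
    (hμ : Integrable fun x => μ x ^ (p + 1)) : Integrable fun x => φ x * μ x ^ p := by
  obtain ⟨C, hC⟩ := hφs.exists_bound_of_continuous hφ
  have hφμ : Integrable fun x => φ x * μ x ^ (p + 1) :=
    hμ.bdd_mul (c := C) hφ.aestronglyMeasurable (.of_forall hC)
  refine ((hφ.integrable_of_hasCompactSupport hφs).norm.add hφμ.norm).mono'
    (hφ.measurable.mul (hmeas.pow_const p)).aestronglyMeasurable (.of_forall fun x => ?_)
  have h1 := Real.rpow_nonneg (hnn x) p
  have h2 := Real.rpow_nonneg (hnn x) (p + 1)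
  simp only [Pi.add_apply, norm_mul, Real.norm_of_nonneg h1, Real.norm_of_nonneg h2]
  nlinarith [mul_le_mul_of_nonneg_left (rpow_le_one_add_rpow_add_one (hnn x) hp)
    (norm_nonneg (φ x))]

/-- coercivity step of the Lasry–Lions monotonicity computation:
∫(μ−φ)(μ^θ + V) ≥ ∫(μ−φ)(μ^θ−φ^θ) ≥ 0, where V(η) = (α(1−α)/2)η². -/
theorem stmt_15 (θ : ℝ) (hθ : 0 < θ)
    (α : ℝ) (hα : α = 2 / (2 + θ))
    (R : ℝ) (hR : 0 < R)
    (φ : ℝ → ℝ)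
    (hφ : ∀ r, φ r = (max ((1/2) * α * (1 - α) * (R^2 - r^2)) 0) ^ (1/θ))
    (hφint : (∫ r : ℝ, φ r) = 1)
    (μ : ℝ → ℝ)
    (hmeas : Measurable μ)
    (hnn : ∀ η, 0 ≤ μ η)
    (hint : Integrable μ)
    (hmass : (∫ η : ℝ, μ η) = 1)
    (hLp : Integrable (fun η => (μ η) ^ (θ+1)))
    (hmom : Integrable (fun η => η^2 * μ η)) :
    ((∫ η : ℝ, (μ η - φ η) * ((μ η) ^ θ + (α*(1-α)/2) * η^2)) ≥
      ∫ η : ℝ, (μ η - φ η) * ((μ η) ^ θ - (φ η) ^ θ)) ∧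
    (0 ≤ ∫ η : ℝ, (μ η - φ η) * ((μ η) ^ θ - (φ η) ^ θ)) := by
  have hφnn : ∀ r, 0 ≤ φ r := fun r => by
    rw [hφ]; exact Real.rpow_nonneg (le_max_right _ _) _
  refine ⟨?_, integral_nonneg fun η => sub_mul_rpow_sub_rpow_nonneg (hnn η) (hφnn η) hθ.le⟩
  have hc : 0 ≤ α * (1 - α) / 2 := by
    have h0 : 0 < α := by rw [hα]; positivity
    have h1 : α ≤ 1 := by rw [hα, div_le_one (by positivity)]; linarith
    have := sub_nonneg.2 h1
    positivity
  set c := α * (1 - α) / 2 with hcdef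
  have hφc : ∀ r, φ r = (max (c * (R^2 - r^2)) 0) ^ (1/θ) := fun r => by
    rw [hφ, hcdef]; congr 2; ring
  have hφθ : ∀ r, φ r ^ θ = max (c * (R^2 - r^2)) 0 := fun r => by
    rw [hφc, ← Real.rpow_mul (le_max_right _ _), one_div_mul_cancel hθ.ne', Real.rpow_one]
  have hout : ∀ r, R^2 ≤ r^2 → φ r = 0 := fun r hr => by
    rw [hφc, max_eq_right (mul_nonpos_of_nonneg_of_nonpos hc (sub_nonpos.2 hr)),
      Real.zero_rpow (one_div_pos.2 hθ).ne']
  have hcont : Continuous φ := by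
    rw [funext hφc]
    exact (by fun_prop : Continuous fun r : ℝ => max (c * (R^2 - r^2)) 0).rpow_const
      fun _ => .inr (one_div_pos.2 hθ).le
  have hcontθ : Continuous fun r => φ r ^ θ := hcont.rpow_const fun _ => .inr hθ.le
  have hsupp : HasCompactSupport φ := by
    refine HasCompactSupport.intro (isCompact_Icc (a := -R) (b := R)) fun x hx => hout x ?_
    by_contra! h
    exact hx (abs_le.1 (abs_lt_of_sq_lt_sq h hR.le).le)
  have hsuppθ : HasCompactSupport fun r => φ r ^ θ :=
    hsupp.comp_left (g := fun x : ℝ => x ^ θ) (Real.zero_rpow hθ.ne')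
  obtain ⟨C, hC⟩ := hsuppθ.exists_bound_of_continuous hcontθ
  have hφi : Integrable φ := hcont.integrable_of_hasCompactSupport hsupp
  have hμμ : Integrable fun η => μ η * μ η ^ θ := by
    refine hLp.congr (.of_forall fun η => ?_)
    simp only
    rw [Real.rpow_add_of_nonneg (hnn η) hθ.le zero_le_one, Real.rpow_one, mul_comm]
  have hφμ : Integrable fun η => φ η * μ η ^ θ :=
    integrable_mul_rpow_of_hasCompactSupport hθ.le hcont hsupp hmeas hnn hLp
  have hμφ : Integrable fun η => φ η ^ θ * μ η :=
    hint.bdd_mul (c := C) hcontθ.aestronglyMeasurable (.of_forall hC)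
  have hφφ : Integrable fun η => φ η * φ η ^ θ :=
    (hcont.mul hcontθ).integrable_of_hasCompactSupport hsupp.mul_right
  have hφm : Integrable fun η => φ η * η ^ 2 :=
    (hcont.mul (continuous_pow 2)).integrable_of_hasCompactSupport hsupp.mul_right
  have hF : Integrable fun η => (μ η - φ η) * (μ η ^ θ + c * η ^ 2) := by
    refine ((hμμ.sub hφμ).add ((hmom.sub hφm).const_mul c)).congr (.of_forall fun η => ?_)
    simp only [Pi.add_apply, Pi.sub_apply]
    ring
  have hG : Integrable fun η => (μ η - φ η) * (μ η ^ θ - φ η ^ θ) := by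
    refine ((hμμ.sub hφμ).sub (hμφ.sub hφφ)).congr (.of_forall fun η => ?_)
    simp only [Pi.sub_apply]
    ring
  have hH : Integrable fun η => c * R ^ 2 * (μ η - φ η) := (hint.sub hφi).const_mul _
  have hH0 : ∫ η, c * R ^ 2 * (μ η - φ η) = 0 := by
    rw [integral_const_mul, integral_sub hint hφi, hmass, hφint, sub_self, mul_zero]
  rw [ge_iff_le, ← add_zero (∫ η, (μ η - φ η) * (μ η ^ θ - φ η ^ θ)), ← hH0,
    ← integral_add hG hH]
  refine integral_mono (hG.add hH) hF fun η => ?_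
  simp only
  rcases le_total (R ^ 2) (η ^ 2) with h | h
  · have hθ0 : φ η ^ θ = 0 := by rw [hout η h, Real.zero_rpow hθ.ne']
    rw [hθ0, hout η h]
    nlinarith [mul_nonneg (mul_nonneg hc (sub_nonneg.2 h)) (hnn η)]
  · rw [hφθ, max_eq_left (mul_nonneg hc (sub_nonneg.2 h))]
    exact le_of_eq (by ring)
end
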